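/- Let a > 0 and let σ, k : ℝ → ℝ be bounded continuous functions. Assume σ is not identically zero, a·‖σ‖_∞ < √2, and |k(s)| ≤ ε(s) := ε₀/(1 + s²) for all s with ε₀ ∈ [0, (3a)^{-1}]. Let s₀ with σ(s₀) ≠ 0 and let c > 0 be a constant for which the geodesic Hardy inequality Q₀[ψ] − E₁∥ψ∥²_{H₀} ≥ c∥ρ^{-1}ψ∥²_{H₀} holds with ρ(s,t) := √(1 + (s − s₀)²). Define f₋(s) := √(1 − aε(s)(2 + aε(s))/(1 + a²‖σ‖_∞²)), f₊(s) := √(1 + aε(s)(2 + aε(s))), and w(s,t) := c·min{f₊(0)^{-1}, f₋(0)}/(1 + (s − s₀)²) − E₁·(f₊(s) − f₋(s)). Then for every ψ ∈ C_c^∞(ℝ × (−a,a)): Q[ψ] − E₁·∥ψ∥²_H ≥ ∫_{ℝ×(−a,a)} w(s,t) |ψ(s,t)|² h₀(s,t) ds dt. -/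

import Mathlib

open MeasureTheory Real Set

section StripHardy

open Filter Topology

lemma cos_half_pi_mul_pos {t : ℝ} (h0 : 0 ≤ t) (h1 : t < 1) : 0 < cos (π / 2 * t) := by
  have := pi_pos
  apply cos_pos_of_mem_Ioo
  constructor <;> nlinarith

lemma sin_half_pi_mul_pos {t : ℝ} (h0 : 0 < t) (h1 : t ≤ 1) : 0 < sin (π / 2 * t) := by
  have := pi_pos
  apply sin_pos_of_pos_of_lt_pi <;> nlinarith

lemma hasDerivAt_cos_half_pi_mul (t : ℝ) :
    HasDerivAt (fun t => cos (π / 2 * t)) (-(π / 2 * sin (π / 2 * t))) t := by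
  have h := ((hasDerivAt_id t).const_mul (π / 2)).cos
  simp only [id, mul_one] at h
  convert h using 1; ring

lemma hasDerivAt_sin_half_pi_mul (t : ℝ) :
    HasDerivAt (fun t => sin (π / 2 * t)) (π / 2 * cos (π / 2 * t)) t := by
  have h := ((hasDerivAt_id t).const_mul (π / 2)).sin
  simp only [id, mul_one] at h
  convert h using 1; ring

lemma hasDerivAt_sin_div_cos {t : ℝ} (hc : cos (π / 2 * t) ≠ 0) :
    HasDerivAt (fun t => sin (π / 2 * t) / cos (π / 2 * t))
      (π / 2 * (1 + (sin (π / 2 * t) / cos (π / 2 * t)) ^ 2)) t := by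
  refine ((hasDerivAt_sin_half_pi_mul t).fun_div (hasDerivAt_cos_half_pi_mul t) hc).congr_deriv ?_
  generalize sin (π / 2 * t) = S at *
  generalize cos (π / 2 * t) = C at *
  field_simp
  ring

lemma hasDerivAt_cos_div_sin {t : ℝ} (hs : sin (π / 2 * t) ≠ 0) :
    HasDerivAt (fun t => cos (π / 2 * t) / sin (π / 2 * t))
      (-(π / 2 * (1 + (cos (π / 2 * t) / sin (π / 2 * t)) ^ 2))) t := by
  refine ((hasDerivAt_cos_half_pi_mul t).fun_div (hasDerivAt_sin_half_pi_mul t) hs).congr_deriv ?_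
  generalize sin (π / 2 * t) = S at *
  generalize cos (π / 2 * t) = C at *
  field_simp
  ring

lemma continuousOn_tan_mul_sq {W u : ℝ → ℝ} {r : ℝ} (hr : r < 1) (hW : Continuous W)
    (hu : Continuous u) (hu0 : ∀ t, r ≤ t → u t = 0) :
    ContinuousOn (fun t => W t * (sin (π / 2 * t) / cos (π / 2 * t)) * u t ^ 2) (Icc 0 1) := by
  intro t ht
  apply ContinuousAt.continuousWithinAt
  rcases lt_or_eq_of_le ht.2 with h | h
  · have hc := (cos_half_pi_mul_pos ht.1 h).ne'
    have : Continuous fun t => sin (π / 2 * t) := by fun_prop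
    have : Continuous fun t => cos (π / 2 * t) := by fun_prop
    fun_prop (disch := assumption)
  · have : (fun t => W t * (sin (π / 2 * t) / cos (π / 2 * t)) * u t ^ 2) =ᶠ[nhds t]
        fun _ => 0 := by
      filter_upwards [Ioi_mem_nhds (show r < t by linarith)] with y hy
      simp [hu0 y (le_of_lt hy)]
    exact continuousAt_const.congr this.symm

/-- Monotone-weight Hardy type inequality on a half interval. -/
lemma half_interval_nonneg_of_monotone_weight {W W' u u' : ℝ → ℝ} {r : ℝ} (hr : r < 1)
    (hW : Continuous W) (hWd : ∀ t ∈ Ioo (0 : ℝ) 1, HasDerivAt W (W' t) t)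
    (hW0 : ∀ t ∈ Ioo (0 : ℝ) 1, 0 ≤ W t) (hW'0 : ∀ t ∈ Ioo (0 : ℝ) 1, 0 ≤ W' t)
    (hu : ∀ t, HasDerivAt u (u' t) t) (hu' : Continuous u') (hu0 : ∀ t, r ≤ t → u t = 0) :
    0 ≤ ∫ t in (0 : ℝ)..1, W t * (u' t ^ 2 - π ^ 2 / 4 * u t ^ 2) := by
  have huc : Continuous u := continuous_iff_continuousAt.2 fun t => (hu t).continuousAt
  have key := intervalIntegral.sub_le_integral_of_hasDeriv_right_of_le (a := 0) (b := 1)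
    (g := fun t => -(π / 2) * (W t * (sin (π / 2 * t) / cos (π / 2 * t)) * u t ^ 2))
    (g' := fun t => -(π / 2) * ((W' t * (sin (π / 2 * t) / cos (π / 2 * t)) + W t *
      (π / 2 * (1 + (sin (π / 2 * t) / cos (π / 2 * t)) ^ 2))) * u t ^ 2
        + W t * (sin (π / 2 * t) / cos (π / 2 * t)) * (2 * u t * u' t)))
    (φ := fun t => W t * (u' t ^ 2 - π ^ 2 / 4 * u t ^ 2)) zero_le_one
    (continuousOn_const.mul (continuousOn_tan_mul_sq hr hW huc hu0)) ?_ ?_ ?_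
  · simpa using key
  · intro t ht
    have hc := (cos_half_pi_mul_pos ht.1.le ht.2).ne'
    apply HasDerivAt.hasDerivWithinAt
    refine ((((hWd t ht).fun_mul (hasDerivAt_sin_div_cos hc)).fun_mul
      ((hu t).fun_pow 2)).const_mul (-(π / 2))).congr_deriv ?_
    push_cast
    ring
  · exact (by fun_prop : Continuous _).continuousOn.integrableOn_Icc
  · intro t ht
    have hc := (cos_half_pi_mul_pos ht.1.le ht.2)
    have hs := (sin_half_pi_mul_pos ht.1 ht.2.le)
    have h1 := hW0 t ht
    have h2 := hW'0 t ht
    have hT : 0 ≤ sin (π / 2 * t) / cos (π / 2 * t) := by positivity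
    generalize sin (π / 2 * t) / cos (π / 2 * t) = T at *
    have h3 : 0 ≤ W t * (u' t + π / 2 * T * u t) ^ 2 := by positivity
    have h4 : 0 ≤ π / 2 * W' t * T * u t ^ 2 := by positivity
    nlinarith

lemma continuousOn_cot_mul_sq {u u' : ℝ → ℝ} (hu : ∀ t, HasDerivAt u (u' t) t) (hu0 : u 0 = 0) :
    ContinuousOn (fun t => cos (π / 2 * t) / sin (π / 2 * t) * u t ^ 2) (Icc 0 1) := by
  have huc : Continuous u := continuous_iff_continuousAt.2 fun t => (hu t).continuousAt
  intro t ht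
  rcases eq_or_lt_of_le ht.1 with h | h
  · subst h
    have h1 := (hu 0).tendsto_slope
    have h2 := (hasDerivAt_sin_half_pi_mul 0).tendsto_slope
    have h3 : Filter.Tendsto (fun t => cos (π / 2 * t) * u t) (nhdsWithin 0 {0}ᶜ) (nhds 0) := by
      have : Continuous (fun t => cos (π / 2 * t) * u t) := by fun_prop
      have := (this.tendsto 0).mono_left (nhdsWithin_le_nhds (s := {0}ᶜ))
      simpa [hu0] using this
    have h4 := h3.mul (h1.div h2 (by simp [pi_ne_zero]))
    rw [zero_mul] at h4
    have h5 : ContinuousAt (fun t => cos (π / 2 * t) / sin (π / 2 * t) * u t ^ 2) 0 := by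
      rw [continuousAt_iff_punctured_nhds]
      simp only [hu0]
      convert h4 using 2
      · rename_i t
        simp only [slope, Pi.div_apply]
        by_cases ht : t = 0
        · simp [ht, hu0]
        by_cases hs : sin (π / 2 * t) = 0
        · simp [hs]
        · simp [hu0]
          field_simp
      · simp
    exact h5.continuousWithinAt
  · have hc := (sin_half_pi_mul_pos h ht.2).ne'
    apply ContinuousAt.continuousWithinAt
    have : Continuous fun t => sin (π / 2 * t) := by fun_prop
    have : Continuous fun t => cos (π / 2 * t) := by fun_prop
    fun_prop (disch := assumption)

/-- Spectral-gap lower bound on a half interval with an increasing weight `H ≥ 1`. -/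
lemma half_interval_gap {H p u u' : ℝ → ℝ} {r : ℝ} (hr : r < 1)
    (hH : Continuous H) (hp : Continuous p) (hHd : ∀ t, HasDerivAt H (p t) t)
    (hH1 : ∀ t ∈ Ioo (0 : ℝ) 1, 1 ≤ H t) (hp0 : ∀ t ∈ Ioo (0 : ℝ) 1, 0 ≤ p t)
    (hu : ∀ t, HasDerivAt u (u' t) t) (hu' : Continuous u') (hu0 : ∀ t, r ≤ t → u t = 0)
    (v : ℝ) :
    0 ≤ ∫ t in (0 : ℝ)..1, (H t * (u' t ^ 2 - π ^ 2 / 4 * u t ^ 2)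
      - 3 * (π ^ 2 / 4) * (u t - u 0 * cos (π / 2 * t)) ^ 2
      - v * (p t * (π / 2 * sin (π / 2 * t)) * u t)
      + 1 / 4 * v ^ 2 * (p t * (π / 2 * sin (π / 2 * t)) * cos (π / 2 * t))) := by
  have huc : Continuous u := continuous_iff_continuousAt.2 fun t => (hu t).continuousAt
  have hz : ∀ t, HasDerivAt (fun t => u t - u 0 * cos (π / 2 * t))
      (u' t + u 0 * (π / 2 * sin (π / 2 * t))) t := fun t => by
    exact ((hu t).fun_sub ((hasDerivAt_cos_half_pi_mul t).const_mul (u 0))).congr_deriv (by ring)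
  have key := intervalIntegral.sub_le_integral_of_hasDeriv_right_of_le (a := 0) (b := 1)
    (g := fun t => -(π / 2) * (H t * (sin (π / 2 * t) / cos (π / 2 * t)) * u t ^ 2)
      + π / 2 * (cos (π / 2 * t) / sin (π / 2 * t) * (u t - u 0 * cos (π / 2 * t)) ^ 2))
    (g' := fun t => -(π / 2) * ((p t * (sin (π / 2 * t) / cos (π / 2 * t)) + H t *
      (π / 2 * (1 + (sin (π / 2 * t) / cos (π / 2 * t)) ^ 2))) * u t ^ 2
        + H t * (sin (π / 2 * t) / cos (π / 2 * t)) * (2 * u t * u' t))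
      + π / 2 * (-(π / 2 * (1 + (cos (π / 2 * t) / sin (π / 2 * t)) ^ 2)) *
          (u t - u 0 * cos (π / 2 * t)) ^ 2 + (cos (π / 2 * t) / sin (π / 2 * t)) *
          (2 * (u t - u 0 * cos (π / 2 * t)) * (u' t + u 0 * (π / 2 * sin (π / 2 * t))))))
    (φ := fun t => (H t * (u' t ^ 2 - π ^ 2 / 4 * u t ^ 2)
      - 3 * (π ^ 2 / 4) * (u t - u 0 * cos (π / 2 * t)) ^ 2
      - v * (p t * (π / 2 * sin (π / 2 * t)) * u t)
      + 1 / 4 * v ^ 2 * (p t * (π / 2 * sin (π / 2 * t)) * cos (π / 2 * t)))) zero_le_one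
    ((continuousOn_const.mul (continuousOn_tan_mul_sq hr hH huc hu0)).add
      (continuousOn_const.mul (continuousOn_cot_mul_sq hz (by simp)))) ?_ ?_ ?_
  · simpa using key
  · intro t ht
    have hc := (cos_half_pi_mul_pos ht.1.le ht.2).ne'
    have hs := (sin_half_pi_mul_pos ht.1 ht.2.le).ne'
    apply HasDerivAt.hasDerivWithinAt
    refine (((((hHd t).fun_mul (hasDerivAt_sin_div_cos hc)).fun_mul
      ((hu t).fun_pow 2)).const_mul (-(π / 2))).fun_add
      (((hasDerivAt_cos_div_sin hs).fun_mul ((hz t).fun_pow 2)).const_mul (π / 2))).congr_deriv ?_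
    push_cast
    ring
  · exact (by fun_prop : Continuous _).continuousOn.integrableOn_Icc
  · intro t ht
    have hc := (cos_half_pi_mul_pos ht.1.le ht.2)
    have hs := (sin_half_pi_mul_pos ht.1 ht.2.le)
    have h1 := hH1 t ht
    have h2 := hp0 t ht
    generalize cos (π / 2 * t) = C at *
    generalize sin (π / 2 * t) = S at *
    obtain ⟨T, hT⟩ : ∃ T, T = S / C := ⟨_, rfl⟩
    have hT0 : 0 < T := by rw [hT]; positivity
    obtain rfl : S = T * C := by rw [hT]; field_simp
    have e1 : T * C / C = T := by field_simp
    have e2 : C / (T * C) = T⁻¹ := by field_simp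
    rw [e1, e2]
    have h3 : 0 ≤ (H t - 1) * (u' t + π / 2 * T * u t) ^ 2 :=
      mul_nonneg (by linarith) (sq_nonneg _)
    have h4 : 0 ≤ π / 2 * p t * T * (u t - v * C / 2) ^ 2 := by positivity
    have h5 := sq_nonneg ((u' t + u 0 * (π / 2 * (T * C))) + π / 2 * (T - T⁻¹) * (u t - u 0 * C))
    have e3 : T * T⁻¹ = 1 := mul_inv_cancel₀ hT0.ne'
    generalize T⁻¹ = R at *
    have : ∀ A B : ℝ, A - B = (H t - 1) * (u' t + π / 2 * T * u t) ^ 2 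
        + π / 2 * p t * T * (u t - v * C / 2) ^ 2 
        + ((u' t + u 0 * (π / 2 * (T * C))) + π / 2 * (T - R) * (u t - u 0 * C)) ^ 2 → B ≤ A :=
      fun A B h => by linarith
    apply this
    linear_combination (π ^ 2 / 2 * (u t - u 0 * C) ^ 2) * e3

/-- The transverse weight of the strip in the absence of geodesic curvature. -/
noncomputable def geoWeight (q t : ℝ) : ℝ := √(1 + t ^ 2 * q)

/-- The transverse derivative of `geoWeight`. -/
noncomputable def geoSlope (q t : ℝ) : ℝ := t * q / geoWeight q t

/-- The transverse weight of the strip. -/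
noncomputable def stripWeight (k q t : ℝ) : ℝ := √((1 - t * k) ^ 2 + t ^ 2 * q)

lemma one_le_geoWeight {q : ℝ} (hq : 0 ≤ q) (t : ℝ) : 1 ≤ geoWeight q t := by
  rw [geoWeight, Real.one_le_sqrt]
  nlinarith [mul_nonneg (sq_nonneg t) hq]

lemma geoWeight_pos {q : ℝ} (hq : 0 ≤ q) (t : ℝ) : 0 < geoWeight q t :=
  zero_lt_one.trans_le (one_le_geoWeight hq t)

lemma geoWeight_sq {q : ℝ} (hq : 0 ≤ q) (t : ℝ) : geoWeight q t ^ 2 = 1 + t ^ 2 * q :=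
  Real.sq_sqrt (by positivity)

@[simp] lemma geoWeight_neg (q t : ℝ) : geoWeight q (-t) = geoWeight q t := by
  simp [geoWeight]

@[simp] lemma geoSlope_neg (q t : ℝ) : geoSlope q (-t) = -geoSlope q t := by
  simp [geoSlope, neg_div]

lemma stripWeight_neg (k q t : ℝ) : stripWeight k q (-t) = stripWeight (-k) q t := by
  simp [stripWeight]

@[fun_prop] lemma Continuous.geoWeight {X : Type*} [TopologicalSpace X] {f g : X → ℝ}
    (hf : Continuous f) (hg : Continuous g) : Continuous fun x => geoWeight (f x) (g x) := by
  unfold _root_.geoWeight; fun_prop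

@[fun_prop] lemma Continuous.stripWeight {X : Type*} [TopologicalSpace X] {e f g : X → ℝ}
    (he : Continuous e) (hf : Continuous f) (hg : Continuous g) :
    Continuous fun x => stripWeight (e x) (f x) (g x) := by
  unfold _root_.stripWeight; fun_prop

lemma continuous_geoSlope {q : ℝ} (hq : 0 ≤ q) : Continuous (geoSlope q) := by
  unfold geoSlope
  exact Continuous.div (by fun_prop) (by fun_prop) fun t => (geoWeight_pos hq t).ne'

lemma hasDerivAt_geoWeight {q : ℝ} (hq : 0 ≤ q) (t : ℝ) :
    HasDerivAt (geoWeight q) (geoSlope q t) t := by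
  have h1 : HasDerivAt (fun t : ℝ => 1 + t ^ 2 * q) (2 * t * q) t := by
    refine ((((hasDerivAt_id t).fun_pow 2).mul_const q).const_add 1).congr_deriv ?_
    simp
  refine (h1.sqrt (by positivity)).congr_deriv ?_
  rw [geoSlope, geoWeight]
  have : 0 < √(1 + t ^ 2 * q) := geoWeight_pos hq t
  field_simp

lemma stripWeight_sq {q : ℝ} (hq : 0 ≤ q) (k t : ℝ) :
    stripWeight k q t ^ 2 = (1 - t * k) ^ 2 + t ^ 2 * q :=
  Real.sq_sqrt (by positivity)

lemma hasDerivAt_stripWeight {q k t : ℝ} (hq : 0 ≤ q) (hk : t * k < 1) :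
    HasDerivAt (stripWeight k q) ((-k * (1 - t * k) + t * q) / stripWeight k q t) t := by
  have h0 : 0 < (1 - t * k) ^ 2 + t ^ 2 * q := by
    have : 0 < 1 - t * k := by linarith
    positivity
  have h1 : HasDerivAt (fun t : ℝ => (1 - t * k) ^ 2 + t ^ 2 * q)
      (2 * (-k * (1 - t * k) + t * q)) t := by
    refine (((((hasDerivAt_id t).mul_const k).const_sub 1).fun_pow 2).fun_add
      (((hasDerivAt_id t).fun_pow 2).mul_const q)).congr_deriv ?_
    simp
    ring
  refine (h1.sqrt h0.ne').congr_deriv ?_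
  rw [stripWeight]
  have : 0 < √((1 - t * k) ^ 2 + t ^ 2 * q) := Real.sqrt_pos.2 h0
  field_simp

lemma one_sub_mul_geoWeight_le {q k x t : ℝ} (hq : 0 ≤ q) (hk : |k| ≤ x) (hx : x ≤ 1)
    (ht : |t| ≤ 1) : (1 - x) * geoWeight q t ≤ stripWeight k q t := by
  have hx0 : 0 ≤ x := (abs_nonneg k).trans hk
  apply Real.le_sqrt_of_sq_le
  rw [mul_pow, geoWeight_sq hq]
  have h1 : |t * k| ≤ x := by
    rw [abs_mul]
    nlinarith [abs_nonneg k, abs_nonneg t]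
  have h2 := (abs_le.1 h1).2
  have h3 : (1 - x) ^ 2 ≤ (1 - t * k) ^ 2 := pow_le_pow_left₀ (by linarith) (by linarith) 2
  have h4 : (1 - x) ^ 2 ≤ 1 := pow_le_one₀ (by linarith) (by linarith)
  nlinarith [mul_nonneg (sq_nonneg t) hq]

lemma stripWeight_le_geoWeight_of_nonneg {q k t : ℝ} (h0 : 0 ≤ t * k) (h1 : t * k ≤ 1) :
    stripWeight k q t ≤ geoWeight q t := by
  apply Real.sqrt_le_sqrt
  nlinarith

/-- Transverse perturbation bound on a half interval. -/
lemma half_interval_strip_lower {q k x r : ℝ} {u u' : ℝ → ℝ} (hq : 0 ≤ q) (hk : |k| ≤ x)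
    (hx : x < 1) (hr : r < 1) (hu : ∀ t, HasDerivAt u (u' t) t) (hu' : Continuous u')
    (hu0 : ∀ t, r ≤ t → u t = 0) :
    0 ≤ ∫ t in (0 : ℝ)..1, ((stripWeight k q t - (1 - x) * geoWeight q t) *
      (u' t ^ 2 - π ^ 2 / 4 * u t ^ 2) + π ^ 2 / 4 * x * (geoWeight q t * u t ^ 2)) := by
  have huc : Continuous u := continuous_iff_continuousAt.2 fun t => (hu t).continuousAt
  have hx0 : 0 ≤ x := (abs_nonneg k).trans hk
  have hW : ∀ t ∈ Icc (0 : ℝ) 1, 0 ≤ stripWeight k q t - (1 - x) * geoWeight q t := fun t ht => by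
    have := one_sub_mul_geoWeight_le hq hk hx.le (abs_le.2 ⟨by linarith [ht.1], ht.2⟩)
    linarith
  rcases le_total k 0 with hk0 | hk0
  · rw [intervalIntegral.integral_add ((by fun_prop : Continuous _).intervalIntegrable _ _)
      ((by fun_prop : Continuous _).intervalIntegrable _ _)]
    apply add_nonneg
    · have htk : ∀ t ∈ Ioo (0 : ℝ) 1, t * k ≤ 0 := fun t ht =>
        mul_nonpos_of_nonneg_of_nonpos ht.1.le hk0
      apply half_interval_nonneg_of_monotone_weight hr (by fun_prop)
        (W' := fun t => (-k * (1 - t * k) + t * q) / stripWeight k q t - (1 - x) * geoSlope q t)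
        _ (fun t ht => hW t ⟨ht.1.le, ht.2.le⟩) _ hu hu' hu0
      · intro t ht
        exact (hasDerivAt_stripWeight hq (by linarith [htk t ht])).fun_sub
          ((hasDerivAt_geoWeight hq t).const_mul _)
      · intro t ht
        have h0 := geoWeight_pos hq t
        have h1 := hW t ⟨ht.1.le, ht.2.le⟩
        have h2 := htk t ht
        have h3 : 0 < stripWeight k q t := by
          have : 0 < (1 - x) * geoWeight q t := mul_pos (by linarith) h0
          linarith
        have h4 : stripWeight k q t * (1 - x) ≤ geoWeight q t := by
          apply Real.le_sqrt_of_sq_le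
          rw [mul_pow, stripWeight_sq hq]
          have h5 : (1 - t * k) * (1 - x) ≤ 1 := by
            have : -(t * k) ≤ x := by nlinarith [ht.2, neg_abs_le k]
            nlinarith
          have h6 : ((1 - t * k) * (1 - x)) ^ 2 ≤ 1 :=
            pow_le_one₀ (mul_nonneg (by linarith) (by linarith)) h5
          have h7 : (1 - x) ^ 2 ≤ 1 := pow_le_one₀ (by linarith) (by linarith)
          nlinarith [mul_nonneg (sq_nonneg t) hq]
        have h5 : (1 - x) * geoSlope q t ≤ t * q / stripWeight k q t := by
          rw [geoSlope, le_div_iff₀ h3]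
          have : (1 - x) * (t * q / geoWeight q t) * stripWeight k q t
            = t * q * (stripWeight k q t * (1 - x)) / geoWeight q t := by ring
          rw [this, div_le_iff₀ h0]
          exact mul_le_mul_of_nonneg_left h4 (mul_nonneg ht.1.le hq)
        have h6 : 0 ≤ (-k * (1 - t * k)) / stripWeight k q t :=
          div_nonneg (mul_nonneg (by linarith) (by linarith)) h3.le
        rw [add_div]
        linarith
    · apply intervalIntegral.integral_nonneg zero_le_one
      intro t ht
      have := (geoWeight_pos hq t).le
      positivity
  · apply intervalIntegral.integral_nonneg zero_le_one
    intro t ht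
    have h1 := hW t ht
    have h2 : stripWeight k q t ≤ geoWeight q t :=
      stripWeight_le_geoWeight_of_nonneg (mul_nonneg ht.1 hk0)
        (by nlinarith [ht.2, ht.1, le_abs_self k])
    have h3 : 0 ≤ (stripWeight k q t - (1 - x) * geoWeight q t) * u' t ^ 2 := by positivity
    have h4 : 0 ≤ (geoWeight q t - stripWeight k q t) * (π ^ 2 / 4 * u t ^ 2) :=
      mul_nonneg (by linarith) (by positivity)
    nlinarith

lemma integral_neg_one_one_eq {F : ℝ → ℝ} (hF : Continuous F) :
    ∫ t in (-1 : ℝ)..1, F t = (∫ t in (0 : ℝ)..1, F t) + ∫ t in (0 : ℝ)..1, F (-t) := by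
  rw [intervalIntegral.integral_comp_neg, neg_zero, add_comm,
    intervalIntegral.integral_add_adjacent_intervals (hF.intervalIntegrable _ _)
      (hF.intervalIntegrable _ _)]

lemma hasDerivAt_comp_neg {u u' : ℝ → ℝ} (hu : ∀ t, HasDerivAt u (u' t) t) (t : ℝ) :
    HasDerivAt (fun t => u (-t)) (-u' (-t)) t := by
  exact ((hu (-t)).comp t (hasDerivAt_neg t)).congr_deriv (by ring)

/-- Transverse perturbation bound. -/
lemma interval_strip_lower {q k x r : ℝ} {u u' : ℝ → ℝ} (hq : 0 ≤ q) (hk : |k| ≤ x)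
    (hx : x < 1) (hr : r < 1) (hu : ∀ t, HasDerivAt u (u' t) t) (hu' : Continuous u')
    (hu0 : ∀ t, r ≤ |t| → u t = 0) :
    0 ≤ ∫ t in (-1 : ℝ)..1, ((stripWeight k q t - (1 - x) * geoWeight q t) *
      (u' t ^ 2 - π ^ 2 / 4 * u t ^ 2) + π ^ 2 / 4 * x * (geoWeight q t * u t ^ 2)) := by
  have huc : Continuous u := continuous_iff_continuousAt.2 fun t => (hu t).continuousAt
  rw [integral_neg_one_one_eq (by fun_prop)]
  apply add_nonneg
  · exact half_interval_strip_lower hq hk hx hr hu hu' fun t ht =>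
      hu0 t (ht.trans (le_abs_self t))
  · have := half_interval_strip_lower (k := -k) hq (by rwa [abs_neg]) hx hr
      (hasDerivAt_comp_neg hu) (by fun_prop) fun t ht =>
        hu0 (-t) (by rw [abs_neg]; exact ht.trans (le_abs_self t))
    simpa [stripWeight_neg] using this

/-- Transverse spectral gap. -/
lemma interval_gap {q r : ℝ} {u u' : ℝ → ℝ} (hq : 0 ≤ q) (hr : r < 1)
    (hu : ∀ t, HasDerivAt u (u' t) t) (hu' : Continuous u')
    (hu0 : ∀ t, r ≤ |t| → u t = 0) (v : ℝ) :
    0 ≤ ∫ t in (-1 : ℝ)..1, (geoWeight q t * (u' t ^ 2 - π ^ 2 / 4 * u t ^ 2)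
      - 3 * (π ^ 2 / 4) * (u t - u 0 * cos (π / 2 * t)) ^ 2
      - v * (geoSlope q t * (π / 2 * sin (π / 2 * t)) * u t)
      + 1 / 4 * v ^ 2 * (geoSlope q t * (π / 2 * sin (π / 2 * t)) * cos (π / 2 * t))) := by
  have huc : Continuous u := continuous_iff_continuousAt.2 fun t => (hu t).continuousAt
  have hsc := continuous_geoSlope hq
  have hs0 : ∀ t ∈ Ioo (0 : ℝ) 1, 0 ≤ geoSlope q t := fun t ht =>
    div_nonneg (mul_nonneg ht.1.le hq) (geoWeight_pos hq t).le
  rw [integral_neg_one_one_eq (by fun_prop)]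
  apply add_nonneg
  · exact half_interval_gap hr (by fun_prop) hsc (hasDerivAt_geoWeight hq)
      (fun t _ => one_le_geoWeight hq t) hs0 hu hu'
      (fun t ht => hu0 t (ht.trans (le_abs_self t))) v
  · have := half_interval_gap hr (by fun_prop) hsc (hasDerivAt_geoWeight hq)
      (fun t _ => one_le_geoWeight hq t) hs0 (hasDerivAt_comp_neg hu) (by fun_prop)
      (fun t ht => hu0 (-t) (by rw [abs_neg]; exact ht.trans (le_abs_self t))) v
    simpa using this

lemma integral_cos_half_pi_mul_sq : ∫ t in (-1 : ℝ)..1, cos (π / 2 * t) ^ 2 = 1 := by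
  rw [intervalIntegral.integral_comp_mul_left (fun x => cos x ^ 2) (by positivity),
    integral_cos_sq]
  simp

lemma integral_sin_half_pi_mul_sq : ∫ t in (-1 : ℝ)..1, sin (π / 2 * t) ^ 2 = 1 := by
  rw [intervalIntegral.integral_comp_mul_left (fun x => sin x ^ 2) (by positivity),
    integral_sin_sq]
  simp

lemma integral_sin_mul_cos_half_pi_mul :
    ∫ t in (0 : ℝ)..1, π / 2 * sin (π / 2 * t) * cos (π / 2 * t) = 1 / 2 := by
  rw [intervalIntegral.integral_eq_sub_of_hasDerivAt (f := fun t => sin (π / 2 * t) ^ 2 / 2)]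
  · simp
  · intro t _
    refine (((hasDerivAt_sin_half_pi_mul t).fun_pow 2).div_const 2).congr_deriv ?_
    push_cast
    ring
  · exact (by fun_prop : Continuous _).intervalIntegrable _ _

lemma integral_mul_sin_mul_cos_half_pi_mul :
    ∫ t in (0 : ℝ)..1, t * (π / 2 * sin (π / 2 * t) * cos (π / 2 * t)) = 1 / 4 := by
  rw [intervalIntegral.integral_eq_sub_of_hasDerivAt
    (f := fun t => t / 4 + sin (π / 2 * t) * cos (π / 2 * t) / (2 * π)
      - t * cos (π / 2 * t) ^ 2 / 2)]
  · simp
  · intro t _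
    refine ((((hasDerivAt_id t).div_const 4).fun_add (((hasDerivAt_sin_half_pi_mul t).fun_mul
      (hasDerivAt_cos_half_pi_mul t)).div_const (2 * π))).fun_sub
      (((hasDerivAt_id t).fun_mul ((hasDerivAt_cos_half_pi_mul t).fun_pow 2)).div_const
        2)).congr_deriv ?_
    have e := sin_sq_add_cos_sq (π / 2 * t)
    generalize sin (π / 2 * t) = S at *
    generalize cos (π / 2 * t) = C at *
    have := pi_ne_zero
    simp
    field_simp
    linear_combination (-4) * e
  · exact (by fun_prop : Continuous _).intervalIntegrable _ _

lemma cos_half_pi_mul_sq_le {t : ℝ} (ht : |t| ≤ 1) : cos (π / 2 * t) ^ 2 ≤ 1 - t ^ 2 := by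
  have h := Real.mul_abs_le_abs_sin (x := π / 2 * t) (by
    rw [abs_mul, abs_of_pos (by positivity)]
    nlinarith [pi_pos])
  rw [abs_mul, abs_of_pos (by positivity : 0 < π / 2)] at h
  have h1 : |t| ≤ |sin (π / 2 * t)| := by
    calc |t| = 2 / π * (π / 2 * |t|) := by have := pi_ne_zero; field_simp
      _ ≤ _ := h
  have h2 := sq_le_sq.2 h1
  have := sin_sq_add_cos_sq (π / 2 * t)
  linarith

/-- The mass of the transverse ground state in the weight `geoWeight`. -/
noncomputable def modeMass (q : ℝ) : ℝ :=
  ∫ t in (-1 : ℝ)..1, geoWeight q t * cos (π / 2 * t) ^ 2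

/-- The potential felt by the transverse ground state in the weight `geoWeight`. -/
noncomputable def modePotential (q : ℝ) : ℝ :=
  ∫ t in (-1 : ℝ)..1, geoSlope q t * (π / 2 * sin (π / 2 * t)) * cos (π / 2 * t)

lemma modePotential_eq {q : ℝ} (hq : 0 ≤ q) : modePotential q =
    2 * ∫ t in (0 : ℝ)..1, geoSlope q t * (π / 2 * sin (π / 2 * t)) * cos (π / 2 * t) := by
  have := continuous_geoSlope hq
  rw [modePotential, integral_neg_one_one_eq (by fun_prop), two_mul]
  simp

lemma geoWeight_sq_le_three {q t : ℝ} (hq : 0 ≤ q) (hq2 : q ≤ 2) (ht : |t| ≤ 1) :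
    geoWeight q t ^ 2 ≤ 3 := by
  rw [geoWeight_sq hq]
  have : t ^ 2 ≤ 1 := by rw [← sq_abs]; exact pow_le_one₀ (abs_nonneg t) ht
  nlinarith

lemma geoSlope_upper {q t : ℝ} (hq : 0 ≤ q) (hq2 : q ≤ 2) (ht0 : 0 ≤ t) (ht1 : t ≤ 1) :
    geoSlope q t ≤ 0.273 + 1.089 * t := by
  have h0 := geoWeight_pos hq t
  rw [geoSlope, div_le_iff₀ h0]
  have h1 : q * geoWeight 2 t ≤ 2 * geoWeight q t := by
    apply le_of_sq_le_sq _ (by positivity)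
    rw [mul_pow, mul_pow, geoWeight_sq hq, geoWeight_sq zero_le_two]
    nlinarith [mul_nonneg hq (sq_nonneg t), mul_nonneg hq (sub_nonneg.2 hq2)]
  have h2 : 2 * t ≤ (0.273 + 1.089 * t) * geoWeight 2 t := by
    apply le_of_sq_le_sq _ (mul_nonneg (by positivity) (geoWeight_pos zero_le_two t).le)
    rw [mul_pow, mul_pow _ (geoWeight 2 t), geoWeight_sq zero_le_two]
    nlinarith [sq_nonneg (t * (t - 0.4986)), sq_nonneg (t - 0.4986),
      mul_nonneg ht0 (sq_nonneg (t - 0.4986))]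
  have h3 := geoWeight_pos zero_le_two t
  nlinarith

lemma geoSlope_lower {q t : ℝ} (hq : 0 ≤ q) (hq2 : q ≤ 2) (ht0 : 0 ≤ t) (ht1 : t ≤ 1) :
    0.577 * q * t ≤ geoSlope q t := by
  have h0 := geoWeight_pos hq t
  rw [geoSlope, le_div_iff₀ h0]
  have h1 := geoWeight_sq_le_three hq hq2 (abs_le.2 ⟨by linarith, ht1⟩ : |t| ≤ 1)
  have h2 : geoWeight q t ≤ 1.73206 := by
    apply le_of_sq_le_sq _ (by norm_num)
    norm_num
    linarith
  have h3 : 0.577 * geoWeight q t ≤ 1 := by norm_num at h2 ⊢; linarith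
  nlinarith [mul_nonneg hq ht0]

lemma modePotential_le {q : ℝ} (hq : 0 ≤ q) (hq2 : q ≤ 2) : modePotential q ≤ 0.82 := by
  have hc := continuous_geoSlope hq
  rw [modePotential_eq hq]
  have h : (∫ t in (0 : ℝ)..1, geoSlope q t * (π / 2 * sin (π / 2 * t)) * cos (π / 2 * t)) ≤
      ∫ t in (0 : ℝ)..1, (0.273 * (π / 2 * sin (π / 2 * t) * cos (π / 2 * t)) +
        1.089 * (t * (π / 2 * sin (π / 2 * t) * cos (π / 2 * t)))) := by
    apply intervalIntegral.integral_mono_on_of_le_Ioo zero_le_one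
      ((by fun_prop : Continuous _).intervalIntegrable _ _)
      ((by fun_prop : Continuous _).intervalIntegrable _ _)
    intro t ht
    have h1 := geoSlope_upper hq hq2 ht.1.le ht.2.le
    have h2 := cos_half_pi_mul_pos ht.1.le ht.2
    have h3 := sin_half_pi_mul_pos ht.1 ht.2.le
    have h4 : 0 ≤ π / 2 * sin (π / 2 * t) * cos (π / 2 * t) := by positivity
    nlinarith
  rw [intervalIntegral.integral_add ((by fun_prop : Continuous _).intervalIntegrable _ _)
      ((by fun_prop : Continuous _).intervalIntegrable _ _),
    intervalIntegral.integral_const_mul, intervalIntegral.integral_const_mul,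
    integral_sin_mul_cos_half_pi_mul, integral_mul_sin_mul_cos_half_pi_mul] at h
  norm_num at h ⊢
  linarith

lemma le_modePotential {q : ℝ} (hq : 0 ≤ q) (hq2 : q ≤ 2) : 0.2885 * q ≤ modePotential q := by
  have hc := continuous_geoSlope hq
  rw [modePotential_eq hq]
  have h : (∫ t in (0 : ℝ)..1, 0.577 * q * (t * (π / 2 * sin (π / 2 * t) * cos (π / 2 * t)))) ≤
      ∫ t in (0 : ℝ)..1, geoSlope q t * (π / 2 * sin (π / 2 * t)) * cos (π / 2 * t) := by
    apply intervalIntegral.integral_mono_on_of_le_Ioo zero_le_one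
      ((by fun_prop : Continuous _).intervalIntegrable _ _)
      ((by fun_prop : Continuous _).intervalIntegrable _ _)
    intro t ht
    have h1 := geoSlope_lower hq hq2 ht.1.le ht.2.le
    have h2 := cos_half_pi_mul_pos ht.1.le ht.2
    have h3 := sin_half_pi_mul_pos ht.1 ht.2.le
    have h4 : 0 ≤ π / 2 * sin (π / 2 * t) * cos (π / 2 * t) := by positivity
    nlinarith
  rw [intervalIntegral.integral_const_mul, integral_mul_sin_mul_cos_half_pi_mul] at h
  norm_num at h ⊢
  linarith

lemma modePotential_nonneg {q : ℝ} (hq : 0 ≤ q) (hq2 : q ≤ 2) : 0 ≤ modePotential q :=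
  (by positivity : 0 ≤ 0.2885 * q).trans (le_modePotential hq hq2)

lemma one_le_modeMass {q : ℝ} (hq : 0 ≤ q) : 1 ≤ modeMass q := by
  rw [← integral_cos_half_pi_mul_sq]
  apply intervalIntegral.integral_mono_on (by norm_num)
    ((by fun_prop : Continuous _).intervalIntegrable _ _)
    ((by fun_prop : Continuous _).intervalIntegrable _ _)
  intro t _
  nlinarith [one_le_geoWeight hq t, sq_nonneg (cos (π / 2 * t))]

lemma modeMass_le {q : ℝ} (hq : 0 ≤ q) (hq2 : q ≤ 2) : modeMass q ≤ 19 / 15 := by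
  have h : (∫ t in (-1 : ℝ)..1, geoWeight q t * cos (π / 2 * t) ^ 2) ≤
      ∫ t in (-1 : ℝ)..1, (cos (π / 2 * t) ^ 2 + (t ^ 2 - t ^ 4)) := by
    apply intervalIntegral.integral_mono_on (by norm_num)
      ((by fun_prop : Continuous _).intervalIntegrable _ _)
      ((by fun_prop : Continuous _).intervalIntegrable _ _)
    intro t ht
    have h1 := cos_half_pi_mul_sq_le (abs_le.2 ht)
    have h2 : geoWeight q t ≤ 1 + t ^ 2 := by
      apply le_of_sq_le_sq _ (by positivity)
      rw [geoWeight_sq hq]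
      nlinarith [mul_nonneg (sq_nonneg t) (sub_nonneg.2 hq2), sq_nonneg (t ^ 2)]
    nlinarith [mul_nonneg (sq_nonneg t) (sub_nonneg.2 h1), mul_nonneg
      (sub_nonneg.2 h2) (sq_nonneg (cos (π / 2 * t)))]
  rw [intervalIntegral.integral_add ((by fun_prop : Continuous _).intervalIntegrable _ _)
      ((by fun_prop : Continuous _).intervalIntegrable _ _), integral_cos_half_pi_mul_sq,
    intervalIntegral.integral_sub ((by fun_prop : Continuous _).intervalIntegrable _ _)
      ((by fun_prop : Continuous _).intervalIntegrable _ _), integral_pow, integral_pow] at h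
  rw [modeMass]
  norm_num at h ⊢
  linarith

lemma kinetic_poly_aux {x Y : ℝ} (hx0 : 0 ≤ x) (hx : x ≤ 1 / 3) (hY0 : 0 ≤ Y) (hY1 : Y ≤ 1) :
    0 ≤ (0.71 + 0.995 * Y) * (1 + x - (x + 0.45 * (1 - Y) * (1 + x)) * x * Y)
      - (1 - x ^ 2) * Y - (x + 0.45 * (1 - Y) * (1 + x)) * (1 + 2 * Y ^ 2) := by
  have hx' := sub_nonneg.2 hx
  have hY' := sub_nonneg.2 hY1
  have h1 := mul_nonneg hx0 hx'
  have h2 := mul_nonneg hY0 hY'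
  nlinarith [mul_nonneg h1 hY0, mul_nonneg h1 hY', mul_nonneg h2 hx0, mul_nonneg h2 hx',
    mul_nonneg h1 h2, mul_nonneg hx' (sq_nonneg (Y - 0.6)),
    mul_nonneg hx0 (sq_nonneg (Y - 0.6)),
    mul_nonneg (mul_nonneg hx0 hY0) (sq_nonneg (Y - 0.6)),
    mul_nonneg (mul_nonneg hx' hY0) (sq_nonneg (Y - 0.6)),
    mul_nonneg (mul_nonneg h1 hY0) (sq_nonneg (Y - 0.6))]

lemma kinetic_scalar_aux {x Y H : ℝ} (hx0 : 0 ≤ x) (hx : x ≤ 1 / 3) (hY0 : 0 ≤ Y) (hY1 : Y ≤ 1)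
    (hH1 : 1 ≤ H) (hH : H ^ 2 ≤ 1 + 2 * Y ^ 2) :
    (x + 0.45 * (1 - Y) * (1 + x)) * (H * (H + x * Y)) ≤ (1 + x) * (H - (1 - x) * Y) := by
  have hb := kinetic_poly_aux hx0 hx hY0 hY1
  have hY' := sub_nonneg.2 hY1
  have hG0 : 0 ≤ x + 0.45 * (1 - Y) * (1 + x) := by positivity
  have ha : (x + 0.45 * (1 - Y) * (1 + x)) * (1 + x * Y) ≤ (1 + x) * (1 - (1 - x) * Y) := by
    have h1 : 0 ≤ 1 - 0.45 * (1 + x) * (1 + x * Y) := by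
      have : x * Y ≤ 1 / 3 := by nlinarith
      have : (1 + x) * (1 + x * Y) ≤ 4 / 3 * (4 / 3) := by gcongr <;> linarith
      nlinarith
    nlinarith [mul_nonneg hY' h1]
  have hG1 : x + 0.45 * (1 - Y) * (1 + x) ≤ 1 := by nlinarith
  have hR : (0.71 + 0.995 * Y) ^ 2 ≤ 1 + 2 * Y ^ 2 := by nlinarith [sq_nonneg (Y - 0.7)]
  generalize x + 0.45 * (1 - Y) * (1 + x) = G at *
  generalize 0.71 + 0.995 * Y = R at *
  have hGY : 0 ≤ 1 + x - G * x * Y := by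
    have : G * (x * Y) ≤ 1 * (1 / 3 * 1) := by gcongr
    nlinarith
  rcases le_total R H with hRH | hRH
  · nlinarith [mul_le_mul_of_nonneg_left hH hG0, mul_le_mul_of_nonneg_right hRH hGY]
  · have hb' : G * R ^ 2 - (1 + x - G * x * Y) * R + (1 - x ^ 2) * Y ≤ 0 := by
      nlinarith [mul_le_mul_of_nonneg_left hR hG0]
    rcases eq_or_lt_of_le (hH1.trans hRH) with h | h
    · obtain rfl : H = 1 := le_antisymm (hRH.trans h.symm.le) hH1
      nlinarith
    · have h1 : (R - 1) * (G * H ^ 2 - (1 + x - G * x * Y) * H + (1 - x ^ 2) * Y) ≤ 0 := by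
        have e1 : (R - H) * (G - (1 + x - G * x * Y) + (1 - x ^ 2) * Y) ≤ 0 :=
          mul_nonpos_of_nonneg_of_nonpos (by linarith) (by nlinarith)
        have e2 := mul_nonpos_of_nonneg_of_nonpos (sub_nonneg.2 hH1) hb'
        have e3 : 0 ≤ G * ((H - 1) * ((R - H) * (R - 1))) :=
          mul_nonneg hG0 (mul_nonneg (by linarith) (mul_nonneg (by linarith) (by linarith)))
        nlinarith
      have := nonpos_of_mul_nonpos_right h1 (sub_pos.2 h)
      nlinarith

lemma inv_stripWeight_lower {q k x t : ℝ} (hq : 0 ≤ q) (hq2 : q ≤ 2) (hk : |k| ≤ x)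
    (hx : x ≤ 1 / 3) (ht : |t| ≤ 1) :
    (1 - x) * (geoWeight q t)⁻¹ + (x ^ 2 / (1 + x) + 0.45 * x * (1 - |t|)) ≤
      (stripWeight k q t)⁻¹ := by
  have hx0 : 0 ≤ x := (abs_nonneg k).trans hk
  have hH := one_le_geoWeight hq t
  have hpos : 0 < stripWeight k q t :=
    (mul_pos (by linarith) (geoWeight_pos hq t)).trans_le
      (one_sub_mul_geoWeight_le hq hk (by linarith) ht)
  have h1 : stripWeight k q t ≤ geoWeight q t + x * |t| := by
    apply le_of_sq_le_sq _ (by positivity)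
    have e : |t * k| ≤ x * |t| := by
      rw [abs_mul, mul_comm]; gcongr
    rw [stripWeight_sq hq, add_sq, geoWeight_sq hq, mul_pow, sq_abs]
    have h2 : (1 - t * k) ^ 2 ≤ (1 + x * |t|) ^ 2 := by
      apply sq_le_sq'
      · nlinarith [(abs_le.1 e).2]
      · nlinarith [(abs_le.1 e).1]
    have h3 : x * |t| ≤ geoWeight q t * (x * |t|) := le_mul_of_one_le_left (by positivity) hH
    nlinarith [sq_abs t]
  have h2 : geoWeight q t ^ 2 ≤ 1 + 2 * |t| ^ 2 := by
    rw [geoWeight_sq hq, sq_abs]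
    nlinarith [sq_nonneg t]
  have h3 := kinetic_scalar_aux hx0 hx (abs_nonneg t) ht hH h2
  refine le_trans ?_ (inv_anti₀ hpos h1)
  generalize geoWeight q t = H at *
  generalize |t| = Y at *
  have hH0 : 0 < H := by linarith
  have hd : 0 < H + x * Y := hpos.trans_le h1
  have e : (H + x * Y)⁻¹ - ((1 - x) * H⁻¹ + (x ^ 2 / (1 + x) + 0.45 * x * (1 - Y))) =
      x * ((1 + x) * (H - (1 - x) * Y) - (x + 0.45 * (1 - Y) * (1 + x)) * (H * (H + x * Y))) /
        ((1 + x) * H * (H + x * Y)) := by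
    field_simp
    ring
  have : 0 ≤ (H + x * Y)⁻¹ - ((1 - x) * H⁻¹ + (x ^ 2 / (1 + x) + 0.45 * x * (1 - Y))) := by
    rw [e]
    exact div_nonneg (mul_nonneg hx0 (sub_nonneg.2 h3)) (by positivity)
  linarith

lemma integral_one_add_abs : ∫ t in (-1 : ℝ)..1, (1 + |t|) = 3 := by
  rw [integral_neg_one_one_eq (by fun_prop)]
  have : ∫ t in (0 : ℝ)..1, (1 + |t|) = ∫ t in (0 : ℝ)..1, (1 + t) := by
    apply intervalIntegral.integral_congr
    intro t ht
    rw [uIcc_of_le zero_le_one] at ht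
    simp [abs_of_nonneg ht.1]
  simp only [abs_neg, this]
  rw [intervalIntegral.integral_add (by simp) (by simp)]
  simp
  norm_num

lemma mode_sq_le {f : ℝ → ℝ} (hf : Continuous f) :
    (∫ t in (-1 : ℝ)..1, cos (π / 2 * t) * f t) ^ 2 ≤
      3 * ∫ t in (-1 : ℝ)..1, (1 - |t|) * f t ^ 2 := by
  obtain ⟨p, hp⟩ : ∃ p, p = ∫ t in (-1 : ℝ)..1, cos (π / 2 * t) * f t := ⟨_, rfl⟩
  have h : (∫ t in (-1 : ℝ)..1, 2 * p * (cos (π / 2 * t) * f t)) ≤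
      ∫ t in (-1 : ℝ)..1, (p ^ 2 / 3 * (1 + |t|) + 3 * ((1 - |t|) * f t ^ 2)) := by
    apply intervalIntegral.integral_mono_on (by norm_num)
      ((by fun_prop : Continuous _).intervalIntegrable _ _)
      ((by fun_prop : Continuous _).intervalIntegrable _ _)
    intro t ht
    have h1 := abs_le.2 ht
    have h2 := cos_half_pi_mul_sq_le h1
    rw [← sq_abs t] at h2
    have h3 := abs_nonneg t
    generalize |t| = Y at *
    generalize cos (π / 2 * t) = C at *
    apply le_of_sq_le_sq _ (add_nonneg (by positivity) (mul_nonneg (by norm_num)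
      (mul_nonneg (by linarith) (sq_nonneg _))))
    have h4 : 0 ≤ p ^ 2 * f t ^ 2 * (1 - Y ^ 2 - C ^ 2) :=
      mul_nonneg (by positivity) (by linarith)
    nlinarith [sq_nonneg (p ^ 2 / 3 * (1 + Y) - 3 * ((1 - Y) * f t ^ 2))]
  rw [intervalIntegral.integral_add ((by fun_prop : Continuous _).intervalIntegrable _ _)
      ((by fun_prop : Continuous _).intervalIntegrable _ _),
    intervalIntegral.integral_const_mul, intervalIntegral.integral_const_mul,
    intervalIntegral.integral_const_mul, integral_one_add_abs, ← hp] at h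
  rw [← hp]
  linarith

lemma continuous_inv_geoWeight {q : ℝ} (hq : 0 ≤ q) : Continuous fun t => (geoWeight q t)⁻¹ :=
  Continuous.inv₀ (by fun_prop) fun t => (geoWeight_pos hq t).ne'

lemma continuousOn_inv_stripWeight {q k : ℝ} (hq : 0 ≤ q) (hk : |k| < 1) :
    ContinuousOn (fun t => (stripWeight k q t)⁻¹) (Icc (-1) 1) := by
  apply ContinuousOn.inv₀ (by fun_prop)
  intro t ht
  have := one_sub_mul_geoWeight_le hq le_rfl hk.le (abs_le.2 ht)
  have := mul_pos (sub_pos.2 hk) (geoWeight_pos hq t)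
  linarith

/-- Lower bound for the longitudinal kinetic energy on a cross-section. -/
lemma interval_kinetic_lower {q k x : ℝ} {f : ℝ → ℝ} (hq : 0 ≤ q) (hq2 : q ≤ 2) (hk : |k| ≤ x)
    (hx : x ≤ 1 / 3) (hf : Continuous f) :
    (1 - x) * (∫ t in (-1 : ℝ)..1, (geoWeight q t)⁻¹ * f t ^ 2) +
      x ^ 2 / (1 + x) * ((∫ t in (-1 : ℝ)..1, f t ^ 2) +
        0.6 * (∫ t in (-1 : ℝ)..1, cos (π / 2 * t) * f t) ^ 2) ≤
    ∫ t in (-1 : ℝ)..1, (stripWeight k q t)⁻¹ * f t ^ 2 := by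
  have hx0 : 0 ≤ x := (abs_nonneg k).trans hk
  have hc := continuous_inv_geoWeight hq
  have h : (∫ t in (-1 : ℝ)..1, ((1 - x) * ((geoWeight q t)⁻¹ * f t ^ 2) +
      (x ^ 2 / (1 + x) * f t ^ 2 + 0.45 * x * ((1 - |t|) * f t ^ 2)))) ≤
      ∫ t in (-1 : ℝ)..1, (stripWeight k q t)⁻¹ * f t ^ 2 := by
    apply intervalIntegral.integral_mono_on (by norm_num)
      ((by fun_prop : Continuous _).intervalIntegrable _ _)
    · apply ContinuousOn.intervalIntegrable
      rw [uIcc_of_le (by norm_num)]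
      exact (continuousOn_inv_stripWeight hq (by linarith)).mul (by fun_prop)
    · intro t ht
      nlinarith [mul_le_mul_of_nonneg_right (inv_stripWeight_lower hq hq2 hk hx (abs_le.2 ht))
        (sq_nonneg (f t))]
  rw [intervalIntegral.integral_add ((by fun_prop : Continuous _).intervalIntegrable _ _)
      ((by fun_prop : Continuous _).intervalIntegrable _ _),
    intervalIntegral.integral_add ((by fun_prop : Continuous _).intervalIntegrable _ _)
      ((by fun_prop : Continuous _).intervalIntegrable _ _),
    intervalIntegral.integral_const_mul, intervalIntegral.integral_const_mul,
    intervalIntegral.integral_const_mul] at h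
  have h2 := mode_sq_le hf
  have h3 : x ^ 2 / (1 + x) ≤ x / 4 := by
    rw [div_le_div_iff₀ (by linarith) (by norm_num)]
    nlinarith
  have h4 := mul_le_mul_of_nonneg_right h3 (sq_nonneg (∫ t in (-1 : ℝ)..1, cos (π / 2 * t) * f t))
  have h5 := mul_le_mul_of_nonneg_left h2 hx0
  nlinarith

/-- Upper bound for the weighted mass on a cross-section. -/
lemma interval_mass_upper {q : ℝ} {u : ℝ → ℝ} (hq : 0 ≤ q) (hq2 : q ≤ 2) (hu : Continuous u) :
    (∫ t in (-1 : ℝ)..1, geoWeight q t * u t ^ 2) ≤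
      1.6 * modeMass q * (∫ t in (-1 : ℝ)..1, cos (π / 2 * t) * u t) ^ 2 +
      2 * ((∫ t in (-1 : ℝ)..1, u t ^ 2) - (∫ t in (-1 : ℝ)..1, cos (π / 2 * t) * u t) ^ 2) := by
  obtain ⟨v, hv⟩ : ∃ v, v = ∫ t in (-1 : ℝ)..1, cos (π / 2 * t) * u t := ⟨_, rfl⟩
  have h : (∫ t in (-1 : ℝ)..1, geoWeight q t * u t ^ 2) ≤
      ∫ t in (-1 : ℝ)..1, ((3.75 * v ^ 2 * (geoWeight q t * cos (π / 2 * t) ^ 2) -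
        2.75 * v ^ 2 * cos (π / 2 * t) ^ 2) +
        (2 * u t ^ 2 - 2 * v * (cos (π / 2 * t) * u t))) := by
    apply intervalIntegral.integral_mono_on (by norm_num)
      ((by fun_prop : Continuous _).intervalIntegrable _ _)
      ((by fun_prop : Continuous _).intervalIntegrable _ _)
    intro t ht
    have h1 := one_le_geoWeight hq t
    have h2 := geoWeight_sq_le_three hq hq2 (abs_le.2 ht)
    have h3 : geoWeight q t ≤ 1.7321 := by
      apply le_of_sq_le_sq _ (by norm_num)
      norm_num
      linarith
    generalize geoWeight q t = H at *
    generalize cos (π / 2 * t) = C at *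
    have h4 := mul_nonneg (sub_nonneg.2 h1) (sq_nonneg (2.75 * (v * C) - (u t - v * C)))
    have h5 : 0 ≤ (2 - (H + (H - 1) / 2.75)) * (u t - v * C) ^ 2 :=
      mul_nonneg (by norm_num at h3 ⊢; linarith) (sq_nonneg _)
    norm_num at h4 h5 ⊢
    nlinarith
  rw [intervalIntegral.integral_add ((by fun_prop : Continuous _).intervalIntegrable _ _)
      ((by fun_prop : Continuous _).intervalIntegrable _ _),
    intervalIntegral.integral_sub ((by fun_prop : Continuous _).intervalIntegrable _ _)
      ((by fun_prop : Continuous _).intervalIntegrable _ _),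
    intervalIntegral.integral_sub ((by fun_prop : Continuous _).intervalIntegrable _ _)
      ((by fun_prop : Continuous _).intervalIntegrable _ _),
    intervalIntegral.integral_const_mul, intervalIntegral.integral_const_mul,
    intervalIntegral.integral_const_mul, intervalIntegral.integral_const_mul,
    integral_cos_half_pi_mul_sq, ← hv] at h
  have h1 := modeMass_le hq hq2
  rw [← hv]
  rw [modeMass] at *
  have h2 : 0 ≤ (19 / 15 - ∫ t in (-1 : ℝ)..1, geoWeight q t * cos (π / 2 * t) ^ 2) * v ^ 2 :=
    mul_nonneg (by linarith) (sq_nonneg _)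
  norm_num at h ⊢
  nlinarith [sq_nonneg v]

lemma sq_mode_le_integral_sq {u : ℝ → ℝ} (hu : Continuous u) :
    (∫ t in (-1 : ℝ)..1, cos (π / 2 * t) * u t) ^ 2 ≤ ∫ t in (-1 : ℝ)..1, u t ^ 2 := by
  obtain ⟨v, hv⟩ : ∃ v, v = ∫ t in (-1 : ℝ)..1, cos (π / 2 * t) * u t := ⟨_, rfl⟩
  have h : 0 ≤ ∫ t in (-1 : ℝ)..1, (u t ^ 2 - (2 * v * (cos (π / 2 * t) * u t)
      - v ^ 2 * cos (π / 2 * t) ^ 2)) :=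
    intervalIntegral.integral_nonneg (by norm_num) fun t _ => by
      nlinarith [sq_nonneg (u t - v * cos (π / 2 * t))]
  rw [intervalIntegral.integral_sub ((by fun_prop : Continuous _).intervalIntegrable _ _)
      ((by fun_prop : Continuous _).intervalIntegrable _ _),
    intervalIntegral.integral_sub ((by fun_prop : Continuous _).intervalIntegrable _ _)
      ((by fun_prop : Continuous _).intervalIntegrable _ _),
    intervalIntegral.integral_const_mul, intervalIntegral.integral_const_mul,
    integral_cos_half_pi_mul_sq, ← hv] at h
  rw [← hv]
  linarith

lemma geoSlope_cross_bound {q t v w S : ℝ} (hq : 0 ≤ q) (hq2 : q ≤ 2) (ht : |t| ≤ 1) :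
    v * (geoSlope q t * (π / 2 * S) * w) ≤
      0.095 * q * v ^ 2 * S ^ 2 + π ^ 2 / 4 / 0.57 * w ^ 2 := by
  have hH := geoWeight_pos hq t
  have h1 : q * (t / geoWeight q t) ^ 2 ≤ 2 / 3 := by
    rw [div_pow, geoWeight_sq hq, ← mul_div_assoc, div_le_iff₀ (by positivity)]
    have : t ^ 2 ≤ 1 := by rw [← sq_abs]; exact pow_le_one₀ (abs_nonneg t) ht
    nlinarith
  have e : geoSlope q t = q * (t / geoWeight q t) := by rw [geoSlope]; ring
  rw [e]
  generalize t / geoWeight q t = y at *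
  have h2 := mul_nonneg hq (sq_nonneg (0.19 * v * S - π / 2 * y * w))
  have h3 : 0 ≤ (2 / 3 - q * y ^ 2) * (π ^ 2 / 4 * w ^ 2) :=
    mul_nonneg (by linarith) (by positivity)
  norm_num at h2 h3 ⊢
  nlinarith

/-- The geodesic transverse form dominates the potential and the excited part. -/
lemma interval_geo_lower {q r : ℝ} {u u' : ℝ → ℝ} (hq : 0 ≤ q) (hq2 : q ≤ 2) (hr : r < 1)
    (hu : ∀ t, HasDerivAt u (u' t) t) (hu' : Continuous u')
    (hu0 : ∀ t, r ≤ |t| → u t = 0) :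
    1 / 4 * (1.6 * modePotential q * (∫ t in (-1 : ℝ)..1, cos (π / 2 * t) * u t) ^ 2 +
      3.28 * ((∫ t in (-1 : ℝ)..1, u t ^ 2) -
        (∫ t in (-1 : ℝ)..1, cos (π / 2 * t) * u t) ^ 2)) ≤
    ∫ t in (-1 : ℝ)..1, geoWeight q t * (u' t ^ 2 - π ^ 2 / 4 * u t ^ 2) := by
  have huc : Continuous u := continuous_iff_continuousAt.2 fun t => (hu t).continuousAt
  have hsc := continuous_geoSlope hq
  have hle := sq_mode_le_integral_sq huc
  obtain ⟨v, hv⟩ : ∃ v, v = ∫ t in (-1 : ℝ)..1, cos (π / 2 * t) * u t := ⟨_, rfl⟩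
  have hgap := interval_gap hq hr hu hu' hu0 v
  rw [← hv] at hle ⊢
  have h1 : (∫ t in (-1 : ℝ)..1, (geoWeight q t * (u' t ^ 2 - π ^ 2 / 4 * u t ^ 2)
      - 3 * (π ^ 2 / 4) * (u t - u 0 * cos (π / 2 * t)) ^ 2
      - v * (geoSlope q t * (π / 2 * sin (π / 2 * t)) * u t)
      + 1 / 4 * v ^ 2 * (geoSlope q t * (π / 2 * sin (π / 2 * t)) * cos (π / 2 * t)))) ≤
      ∫ t in (-1 : ℝ)..1, ((geoWeight q t * (u' t ^ 2 - π ^ 2 / 4 * u t ^ 2)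
        - 3 / 4 * v ^ 2 * (geoSlope q t * (π / 2 * sin (π / 2 * t)) * cos (π / 2 * t))) +
        ((0.095 * q * v ^ 2 * sin (π / 2 * t) ^ 2 - (3 - 1 / 0.57) * (π ^ 2 / 4) * u t ^ 2) +
          ((3 * (π ^ 2 / 4) * (2 * u 0) - π ^ 2 / 4 / 0.57 * (2 * v)) * (cos (π / 2 * t) * u t) +
          (π ^ 2 / 4 / 0.57 * v ^ 2 - 3 * (π ^ 2 / 4) * u 0 ^ 2) * cos (π / 2 * t) ^ 2))) := by
    apply intervalIntegral.integral_mono_on (by norm_num)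
      ((by fun_prop : Continuous _).intervalIntegrable _ _)
      ((by fun_prop : Continuous _).intervalIntegrable _ _)
    intro t ht
    have := geoSlope_cross_bound (v := -v) (w := u t - v * cos (π / 2 * t))
      (S := sin (π / 2 * t)) hq hq2 (abs_le.2 ht)
    norm_num at this ⊢
    nlinarith
  have h2 := hgap.trans h1
  rw [intervalIntegral.integral_add ((by fun_prop : Continuous _).intervalIntegrable _ _)
      ((by fun_prop : Continuous _).intervalIntegrable _ _),
    intervalIntegral.integral_add ((by fun_prop : Continuous _).intervalIntegrable _ _)
      ((by fun_prop : Continuous _).intervalIntegrable _ _),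
    intervalIntegral.integral_add ((by fun_prop : Continuous _).intervalIntegrable _ _)
      ((by fun_prop : Continuous _).intervalIntegrable _ _),
    intervalIntegral.integral_sub ((by fun_prop : Continuous _).intervalIntegrable _ _)
      ((by fun_prop : Continuous _).intervalIntegrable _ _),
    intervalIntegral.integral_sub ((by fun_prop : Continuous _).intervalIntegrable _ _)
      ((by fun_prop : Continuous _).intervalIntegrable _ _),
    intervalIntegral.integral_const_mul, intervalIntegral.integral_const_mul,
    intervalIntegral.integral_const_mul, intervalIntegral.integral_const_mul,
    intervalIntegral.integral_const_mul,
    integral_cos_half_pi_mul_sq, integral_sin_half_pi_mul_sq, ← hv] at h2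
  have h3 := le_modePotential hq hq2
  rw [modePotential] at *
  generalize (∫ t in (-1 : ℝ)..1, geoWeight q t * (u' t ^ 2 - π ^ 2 / 4 * u t ^ 2)) = T at *
  generalize (∫ t in (-1 : ℝ)..1, u t ^ 2) = n at *
  generalize (∫ t in (-1 : ℝ)..1,
    geoSlope q t * (π / 2 * sin (π / 2 * t)) * cos (π / 2 * t)) = τ at *
  have hpi : 2.25 ≤ π ^ 2 / 4 := by nlinarith [pi_gt_three]
  have h4 : 0 ≤ (π ^ 2 / 4 - 2.25) * (n - v ^ 2) := mul_nonneg (by linarith) (by linarith)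
  have h5 : 0 ≤ (τ - 0.2885 * q) * v ^ 2 := mul_nonneg (by linarith) (sq_nonneg _)
  have h6 : 0 ≤ π ^ 2 / 4 * (u 0 - v) ^ 2 := by positivity
  have h7 : 0 ≤ q * v ^ 2 := by positivity
  norm_num at h2 h4 h5 h6 ⊢
  nlinarith

/-- Lower bound for the transverse form of the strip on a cross-section. -/
lemma interval_transverse_lower {q k x x₀ r : ℝ} {u u' : ℝ → ℝ} (hq : 0 ≤ q) (hq2 : q ≤ 2)
    (hk : |k| ≤ x) (hxx : x ≤ x₀) (hx₀ : x₀ ≤ 1 / 3) (hr : r < 1)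
    (hu : ∀ t, HasDerivAt u (u' t) t) (hu' : Continuous u')
    (hu0 : ∀ t, r ≤ |t| → u t = 0) :
    (1 - x₀) * (∫ t in (-1 : ℝ)..1, geoWeight q t * (u' t ^ 2 - π ^ 2 / 4 * u t ^ 2)) +
      x₀ ^ 2 / (1 + x₀) * (1.6 * modePotential q *
        (∫ t in (-1 : ℝ)..1, cos (π / 2 * t) * u t) ^ 2 +
      3.28 * ((∫ t in (-1 : ℝ)..1, u t ^ 2) -
        (∫ t in (-1 : ℝ)..1, cos (π / 2 * t) * u t) ^ 2)) ≤
    (∫ t in (-1 : ℝ)..1, stripWeight k q t * (u' t ^ 2 - π ^ 2 / 4 * u t ^ 2)) +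
      π ^ 2 / 4 * (4 / 3 * x) * ∫ t in (-1 : ℝ)..1, geoWeight q t * u t ^ 2 := by
  have hx0 : 0 ≤ x := (abs_nonneg k).trans hk
  have huc : Continuous u := continuous_iff_continuousAt.2 fun t => (hu t).continuousAt
  have h1 := interval_strip_lower hq hk (by linarith) hr hu hu' hu0
  have h2 := interval_geo_lower hq hq2 hr hu hu' hu0
  have h3 := sq_mode_le_integral_sq huc
  have e : ∀ t, (stripWeight k q t - (1 - x) * geoWeight q t) *
      (u' t ^ 2 - π ^ 2 / 4 * u t ^ 2) + π ^ 2 / 4 * x * (geoWeight q t * u t ^ 2) =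
      stripWeight k q t * (u' t ^ 2 - π ^ 2 / 4 * u t ^ 2) - (1 - x) *
      (geoWeight q t * (u' t ^ 2 - π ^ 2 / 4 * u t ^ 2)) +
        π ^ 2 / 4 * x * (geoWeight q t * u t ^ 2) := fun t => by ring
  simp_rw [e] at h1
  rw [intervalIntegral.integral_add ((by fun_prop : Continuous _).intervalIntegrable _ _)
      ((by fun_prop : Continuous _).intervalIntegrable _ _),
    intervalIntegral.integral_sub ((by fun_prop : Continuous _).intervalIntegrable _ _)
      ((by fun_prop : Continuous _).intervalIntegrable _ _),
    intervalIntegral.integral_const_mul, intervalIntegral.integral_const_mul] at h1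
  have h4 : (∫ t in (-1 : ℝ)..1, u t ^ 2) ≤ ∫ t in (-1 : ℝ)..1, geoWeight q t * u t ^ 2 := by
    apply intervalIntegral.integral_mono_on (by norm_num)
      ((by fun_prop : Continuous _).intervalIntegrable _ _)
      ((by fun_prop : Continuous _).intervalIntegrable _ _)
    intro t _
    nlinarith [one_le_geoWeight hq t, sq_nonneg (u t)]
  have h5 := modePotential_le hq hq2
  have h6 := modePotential_nonneg hq hq2
  generalize (∫ t in (-1 : ℝ)..1, cos (π / 2 * t) * u t) = v at *
  generalize (∫ t in (-1 : ℝ)..1, u t ^ 2) = n at *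
  generalize (∫ t in (-1 : ℝ)..1, geoWeight q t * u t ^ 2) = m at *
  generalize (∫ t in (-1 : ℝ)..1, geoWeight q t * (u' t ^ 2 - π ^ 2 / 4 * u t ^ 2)) = T at *
  generalize (∫ t in (-1 : ℝ)..1, stripWeight k q t * (u' t ^ 2 - π ^ 2 / 4 * u t ^ 2)) = A at *
  obtain ⟨X, hX⟩ : ∃ X, X = 1.6 * modePotential q * v ^ 2 + 3.28 * (n - v ^ 2) := ⟨_, rfl⟩
  rw [← hX] at h2 ⊢
  have hX0 : 0 ≤ X := by rw [hX]; nlinarith [mul_nonneg h6 (sq_nonneg v)]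
  have hXn : X ≤ 3.28 * n := by
    rw [hX]
    have := mul_nonneg (sub_nonneg.2 h5) (sq_nonneg v)
    norm_num at this ⊢
    nlinarith [sq_nonneg v]
  have hpi : 2.46 ≤ π ^ 2 / 4 := by
    have := pi_gt_d2
    norm_num at this ⊢
    nlinarith
  have hn : 0 ≤ n := (sq_nonneg v).trans h3
  have hXm : X ≤ 4 / 3 * (π ^ 2 / 4 * m) := by
    have : 2.46 * n ≤ π ^ 2 / 4 * m := by gcongr
    norm_num at this hXn ⊢
    linarith
  have hκ : x₀ ^ 2 / (1 + x₀) ≤ x₀ / 4 := by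
    rw [div_le_div_iff₀ (by linarith) (by norm_num)]
    nlinarith
  have h7 := mul_le_mul_of_nonneg_right hκ hX0
  have h8 := mul_le_mul_of_nonneg_left h2 (sub_nonneg.2 hxx)
  have h9 := mul_le_mul_of_nonneg_left hXm hx0
  nlinarith

lemma exists_deriv_smoothTransition_bound : ∃ M, ∀ y, |deriv smoothTransition y| ≤ M ∧
    (1 < y → deriv smoothTransition y = 0) := by
  have hc : Continuous (deriv smoothTransition) :=
    (smoothTransition.contDiff (n := 1)).continuous_deriv le_rfl
  obtain ⟨M, hM⟩ := isCompact_Icc.exists_bound_of_continuousOn (s := Icc (0 : ℝ) 1) hc.continuousOn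
  have h1 : ∀ y : ℝ, 1 < y → deriv smoothTransition y = 0 := fun y hy => by
    have : smoothTransition =ᶠ[𝓝 y] fun _ => 1 := by
      filter_upwards [Ioi_mem_nhds hy] with z hz
      exact smoothTransition.one_of_one_le (le_of_lt hz)
    rw [this.deriv_eq, deriv_const]
  have h0 : ∀ y : ℝ, y < 0 → deriv smoothTransition y = 0 := fun y hy => by
    have : smoothTransition =ᶠ[𝓝 y] fun _ => 0 := by
      filter_upwards [Iio_mem_nhds hy] with z hz
      exact smoothTransition.zero_of_nonpos (le_of_lt hz)
    rw [this.deriv_eq, deriv_const]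
  refine ⟨M, fun y => ⟨?_, h1 y⟩⟩
  have hM0 : 0 ≤ M := (norm_nonneg _).trans (hM 0 (by simp))
  rcases lt_or_ge y 0 with h | h
  · simpa [h0 y h] using hM0
  rcases lt_or_ge 1 y with h' | h'
  · simpa [h1 y h'] using hM0
  · exact hM y ⟨h, h'⟩

lemma cos_half_pi_mul_abs_le {t : ℝ} (ht : |t| ≤ 1) : |cos (π / 2 * t)| ≤ π / 2 * (1 - t ^ 2) := by
  have h1 : cos (π / 2 * t) = sin (π / 2 * (1 - |t|)) := by
    rw [mul_sub, mul_one, sin_pi_div_two_sub, ← abs_of_pos (by positivity : 0 < π / 2),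
      ← abs_mul, cos_abs]
    simp [abs_of_pos (by positivity : 0 < π / 2)]
  have h2 : 0 ≤ π / 2 * (1 - |t|) := mul_nonneg (by positivity) (by linarith)
  rw [h1]
  refine (abs_sin_le_abs).trans ?_
  rw [abs_of_nonneg h2]
  gcongr
  rw [← sq_abs]
  nlinarith [abs_nonneg t]

/-- Smooth cut-offs in the open cross-section which are asymptotically invisible to the ground
state. -/
lemma exists_cutoff {ε : ℝ} (hε : 0 < ε) : ∃ J : ℝ → ℝ, ContDiff ℝ (⊤ : ℕ∞) J ∧
    (∃ r < 1, ∀ t, r ≤ |t| → J t = 0) ∧ (∀ t, 0 ≤ J t) ∧ (∀ t, J t ≤ 1) ∧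
    (∫ t in (-1 : ℝ)..1, cos (π / 2 * t) ^ 2 * (1 - J t ^ 2)) ≤ ε ∧
    (∫ t in (-1 : ℝ)..1, cos (π / 2 * t) ^ 2 * deriv J t ^ 2) ≤ ε := by
  obtain ⟨M, hM⟩ := exists_deriv_smoothTransition_bound
  have hM0 : 0 ≤ M := (abs_nonneg _).trans (hM 0).1
  let J : ℕ → ℝ → ℝ := fun n t => smoothTransition (n * (1 - t ^ 2) - 1)
  have hJ : ∀ n, ContDiff ℝ (⊤ : ℕ∞) (J n) := fun n =>
    smoothTransition.contDiff.comp (by fun_prop)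
  have hJc : ∀ n, Continuous (J n) := fun n => (hJ n).continuous
  have hJd : ∀ n, Continuous (deriv (J n)) := fun n => (hJ n).continuous_deriv (by norm_cast)
  have hJ' : ∀ n t, deriv (J n) t = deriv smoothTransition (n * (1 - t ^ 2) - 1) *
      (n * (-(2 * t))) := fun n t => by
    have h1 : HasDerivAt (fun t : ℝ => (n : ℝ) * (1 - t ^ 2) - 1) (n * (-(2 * t))) t := by
      refine ((((hasDerivAt_id t).fun_pow 2).const_sub 1).const_mul (n : ℝ)).sub_const 1
        |>.congr_deriv ?_
      simp
    have h2 := ((smoothTransition.contDiff (n := 1)).differentiable (by simp)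
      (n * (1 - t ^ 2) - 1)).hasDerivAt
    exact (h2.comp t h1).deriv
  have hcos : ∀ t : ℝ, |t| = 1 → cos (π / 2 * t) = 0 := fun t ht => by
    rcases eq_or_eq_neg_of_abs_eq ht with rfl | rfl <;> simp
  have hbig : ∀ t : ℝ, |t| < 1 → ∀ᶠ n : ℕ in atTop, 1 < (n : ℝ) * (1 - t ^ 2) - 1 := fun t ht => by
    have h1 : 0 < 1 - t ^ 2 := by
      rw [← sq_abs]; nlinarith [abs_nonneg t]
    have h2 : Tendsto (fun n : ℕ => (n : ℝ) * (1 - t ^ 2)) atTop atTop :=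
      tendsto_natCast_atTop_atTop.atTop_mul_const h1
    filter_upwards [h2.eventually_gt_atTop 2] with n hn
    linarith
  have hmem : ∀ t ∈ uIoc (-1 : ℝ) 1, |t| ≤ 1 := fun t ht => by
    rw [uIoc_of_le (by norm_num)] at ht
    exact abs_le.2 ⟨ht.1.le, ht.2⟩
  have hl1 : Tendsto (fun n => ∫ t in (-1 : ℝ)..1, cos (π / 2 * t) ^ 2 * (1 - J n t ^ 2))
      atTop (𝓝 (∫ t in (-1 : ℝ)..1, 0)) := by
    apply intervalIntegral.tendsto_integral_filter_of_dominated_convergence (fun _ => 1)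
    · exact Eventually.of_forall fun n =>
        (by have := hJc n; fun_prop : Continuous _).aestronglyMeasurable
    · refine Eventually.of_forall fun n => Eventually.of_forall fun t _ => ?_
      have h1 := smoothTransition.nonneg ((n : ℝ) * (1 - t ^ 2) - 1)
      have h2 := smoothTransition.le_one ((n : ℝ) * (1 - t ^ 2) - 1)
      have h3 : J n t ^ 2 ≤ 1 := pow_le_one₀ h1 h2
      rw [norm_of_nonneg (mul_nonneg (sq_nonneg _) (by linarith))]
      exact mul_le_one₀ (cos_sq_le_one _) (by linarith) (by linarith [sq_nonneg (J n t)])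
    · simp
    · refine Eventually.of_forall fun t ht => ?_
      rcases lt_or_eq_of_le (hmem t ht) with h | h
      · apply tendsto_const_nhds.congr'
        filter_upwards [hbig t h] with n hn
        simp [J, smoothTransition.one_of_one_le hn.le]
      · simp [hcos t h]
  have hl2 : Tendsto (fun n => ∫ t in (-1 : ℝ)..1, cos (π / 2 * t) ^ 2 * deriv (J n) t ^ 2)
      atTop (𝓝 (∫ t in (-1 : ℝ)..1, 0)) := by
    apply intervalIntegral.tendsto_integral_filter_of_dominated_convergence
      (fun _ => (2 * π * M) ^ 2)
    · exact Eventually.of_forall fun n =>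
        (by have := hJd n; fun_prop : Continuous _).aestronglyMeasurable
    · refine Eventually.of_forall fun n => Eventually.of_forall fun t ht => ?_
      have ht1 := hmem t ht
      rw [← mul_pow, norm_pow]
      apply pow_le_pow_left₀ (norm_nonneg _)
      rw [Real.norm_eq_abs, hJ', abs_mul, abs_mul]
      rcases lt_or_ge 1 ((n : ℝ) * (1 - t ^ 2) - 1) with h | h
      · rw [(hM _).2 h]
        simp only [abs_zero, zero_mul, mul_zero]
        positivity
      · have h1 := cos_half_pi_mul_abs_le ht1
        have h2 := (hM ((n : ℝ) * (1 - t ^ 2) - 1)).1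
        have h3 : |(n : ℝ) * -(2 * t)| ≤ n * 2 := by
          rw [abs_mul, abs_neg, abs_mul, Nat.abs_cast, abs_two]
          gcongr
          linarith
        have h4 : 0 ≤ 1 - t ^ 2 := by
          rw [← sq_abs]; nlinarith [abs_nonneg t]
        calc _ ≤ π / 2 * (1 - t ^ 2) * (M * (n * 2)) := by gcongr
          _ = π * M * (n * (1 - t ^ 2)) := by ring
          _ ≤ π * M * 2 := by gcongr; linarith
          _ = 2 * π * M := by ring
    · simp
    · refine Eventually.of_forall fun t ht => ?_
      rcases lt_or_eq_of_le (hmem t ht) with h | h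
      · apply tendsto_const_nhds.congr'
        filter_upwards [hbig t h] with n hn
        rw [hJ', (hM _).2 hn]
        simp
      · simp [hcos t h]
  simp only [intervalIntegral.integral_zero] at hl1 hl2
  obtain ⟨n, h1, h2, hn⟩ := ((hl1.eventually_le_const hε).and ((hl2.eventually_le_const hε).and
    (eventually_ge_atTop 1))).exists
  have hn' : (0 : ℝ) < n := by exact_mod_cast hn
  refine ⟨J n, hJ n, ⟨√(1 - 1 / n), ?_, ?_⟩, fun t => smoothTransition.nonneg _,
    fun t => smoothTransition.le_one _, h1, h2⟩
  · rw [sqrt_lt' one_pos]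
    have : 0 < 1 / (n : ℝ) := by positivity
    linarith
  · intro t ht
    apply smoothTransition.zero_of_nonpos
    have h3 := (sqrt_le_left (abs_nonneg t)).1 ht
    rw [sq_abs] at h3
    have : (n : ℝ) * (1 - t ^ 2) ≤ n * (1 / n) := by gcongr; linarith
    rw [mul_one_div_cancel hn'.ne'] at this
    linarith

lemma modePotential_integrand_nonneg {q t : ℝ} (hq : 0 ≤ q) (ht : |t| ≤ 1) :
    0 ≤ geoSlope q t * (π / 2 * sin (π / 2 * t)) * cos (π / 2 * t) := by
  have h : ∀ y : ℝ, 0 ≤ y → y ≤ 1 →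
      0 ≤ geoSlope q y * (π / 2 * sin (π / 2 * y)) * cos (π / 2 * y) := fun y h0 h1 => by
    have := pi_pos
    have h2 : 0 ≤ cos (π / 2 * y) := cos_nonneg_of_mem_Icc ⟨by nlinarith, by nlinarith⟩
    have h3 : 0 ≤ sin (π / 2 * y) := sin_nonneg_of_nonneg_of_le_pi (by positivity) (by nlinarith)
    have h4 := geoWeight_pos hq y
    rw [geoSlope]
    positivity
  rcases le_total 0 t with h0 | h0
  · exact h t h0 ((le_abs_self t).trans ht)
  · simpa using h (-t) (by linarith) ((neg_le_abs t).trans ht)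

lemma trial_transverse_le {q ε : ℝ} {J : ℝ → ℝ} (hq : 0 ≤ q) (hq2 : q ≤ 2)
    (hJ : ContDiff ℝ (⊤ : ℕ∞) J) (hJ0 : ∀ t, 0 ≤ J t) (hJ1 : ∀ t, J t ≤ 1)
    (hε : (∫ t in (-1 : ℝ)..1, cos (π / 2 * t) ^ 2 * deriv J t ^ 2) ≤ ε) :
    (∫ t in (-1 : ℝ)..1, geoWeight q t * ((-(π / 2 * sin (π / 2 * t)) * J t +
      cos (π / 2 * t) * deriv J t) ^ 2 - π ^ 2 / 4 * (cos (π / 2 * t) * J t) ^ 2)) ≤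
    modePotential q + 2 * ε := by
  have hJc : Continuous J := hJ.continuous
  have hJd : Continuous (deriv J) := hJ.continuous_deriv (by norm_cast)
  have hJh : ∀ t, HasDerivAt J (deriv J t) t := fun t =>
    (hJ.differentiable (by simp) t).hasDerivAt
  have hsc := continuous_geoSlope hq
  let g : ℝ → ℝ := fun t =>
    geoWeight q t * (cos (π / 2 * t) * -(π / 2 * sin (π / 2 * t))) * J t ^ 2
  let g' : ℝ → ℝ := fun t => (geoSlope q t * (cos (π / 2 * t) * -(π / 2 * sin (π / 2 * t))) +
      geoWeight q t * ((π / 2 * sin (π / 2 * t)) ^ 2 - π ^ 2 / 4 * cos (π / 2 * t) ^ 2)) * J t ^ 2 +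
      geoWeight q t * (cos (π / 2 * t) * -(π / 2 * sin (π / 2 * t))) * (2 * J t * deriv J t)
  have hg' : Continuous g' := by fun_prop
  have hgi : ∫ t in (-1 : ℝ)..1, g' t = 0 := by
    rw [intervalIntegral.integral_eq_sub_of_hasDerivAt (f := g)]
    · simp [g]
    · intro t _
      refine (((hasDerivAt_geoWeight hq t).fun_mul ((hasDerivAt_cos_half_pi_mul t).fun_mul
        ((hasDerivAt_sin_half_pi_mul t).const_mul (π / 2)).fun_neg)).fun_mul
        ((hJh t).fun_pow 2)).congr_deriv ?_
      simp only [g']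
      push_cast
      ring
    · exact hg'.intervalIntegrable _ _
  have h : (∫ t in (-1 : ℝ)..1, geoWeight q t * ((-(π / 2 * sin (π / 2 * t)) * J t +
      cos (π / 2 * t) * deriv J t) ^ 2 - π ^ 2 / 4 * (cos (π / 2 * t) * J t) ^ 2)) ≤
      ∫ t in (-1 : ℝ)..1, ((g' t +
        geoSlope q t * (π / 2 * sin (π / 2 * t)) * cos (π / 2 * t)) +
        2 * (cos (π / 2 * t) ^ 2 * deriv J t ^ 2)) := by
    apply intervalIntegral.integral_mono_on (by norm_num)
      ((by fun_prop : Continuous _).intervalIntegrable _ _)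
      ((by fun_prop : Continuous _).intervalIntegrable _ _)
    intro t ht
    have h1 := modePotential_integrand_nonneg hq (abs_le.2 ht)
    have h2 : geoWeight q t ≤ 2 := by
      apply le_of_sq_le_sq _ (by norm_num)
      linarith [geoWeight_sq_le_three hq hq2 (abs_le.2 ht)]
    have h3 : J t ^ 2 ≤ 1 := pow_le_one₀ (hJ0 t) (hJ1 t)
    have h4 := mul_nonneg h1 (sub_nonneg.2 h3)
    have h5 := mul_nonneg (sub_nonneg.2 h2) (sq_nonneg (cos (π / 2 * t) * deriv J t))
    simp only [g']
    nlinarith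
  rw [intervalIntegral.integral_add ((by fun_prop : Continuous _).intervalIntegrable _ _)
      ((by fun_prop : Continuous _).intervalIntegrable _ _),
    intervalIntegral.integral_add (hg'.intervalIntegrable _ _)
      ((by fun_prop : Continuous _).intervalIntegrable _ _), hgi,
    intervalIntegral.integral_const_mul] at h
  rw [modePotential]
  linarith

lemma trial_mass_ge {q ε : ℝ} {J : ℝ → ℝ} (hq : 0 ≤ q) (hq2 : q ≤ 2)
    (hJ : Continuous J) (hJ0 : ∀ t, 0 ≤ J t) (hJ1 : ∀ t, J t ≤ 1)
    (hε : (∫ t in (-1 : ℝ)..1, cos (π / 2 * t) ^ 2 * (1 - J t ^ 2)) ≤ ε) :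
    modeMass q - 2 * ε ≤ ∫ t in (-1 : ℝ)..1, geoWeight q t * (cos (π / 2 * t) * J t) ^ 2 := by
  have h : (∫ t in (-1 : ℝ)..1, (geoWeight q t * cos (π / 2 * t) ^ 2 -
      2 * (cos (π / 2 * t) ^ 2 * (1 - J t ^ 2)))) ≤
      ∫ t in (-1 : ℝ)..1, geoWeight q t * (cos (π / 2 * t) * J t) ^ 2 := by
    apply intervalIntegral.integral_mono_on (by norm_num)
      ((by fun_prop : Continuous _).intervalIntegrable _ _)
      ((by fun_prop : Continuous _).intervalIntegrable _ _)
    intro t ht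
    have h2 : geoWeight q t ≤ 2 := by
      apply le_of_sq_le_sq _ (by norm_num)
      linarith [geoWeight_sq_le_three hq hq2 (abs_le.2 ht)]
    have h3 : J t ^ 2 ≤ 1 := pow_le_one₀ (hJ0 t) (hJ1 t)
    have h4 := mul_nonneg (mul_nonneg (sub_nonneg.2 h2) (sq_nonneg (cos (π / 2 * t))))
      (sub_nonneg.2 h3)
    nlinarith
  rw [intervalIntegral.integral_sub ((by fun_prop : Continuous _).intervalIntegrable _ _)
      ((by fun_prop : Continuous _).intervalIntegrable _ _),
    intervalIntegral.integral_const_mul] at h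
  rw [modeMass]
  linarith

lemma trial_kinetic_le {q : ℝ} {J : ℝ → ℝ} (hq : 0 ≤ q)
    (hJ : Continuous J) (hJ0 : ∀ t, 0 ≤ J t) (hJ1 : ∀ t, J t ≤ 1) :
    (∫ t in (-1 : ℝ)..1, (geoWeight q t)⁻¹ * (cos (π / 2 * t) * J t) ^ 2) ≤ 1 := by
  have hc := continuous_inv_geoWeight hq
  refine le_of_le_of_eq ?_ integral_cos_half_pi_mul_sq
  apply intervalIntegral.integral_mono_on (by norm_num)
    ((by fun_prop : Continuous _).intervalIntegrable _ _)
    ((by fun_prop : Continuous _).intervalIntegrable _ _)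
  intro t _
  have h1 := inv_le_one_of_one_le₀ (one_le_geoWeight hq t)
  have h2 : J t ^ 2 ≤ 1 := pow_le_one₀ (hJ0 t) (hJ1 t)
  have h3 := inv_nonneg.2 (geoWeight_pos hq t).le
  rw [mul_pow]
  calc _ ≤ 1 * (cos (π / 2 * t) ^ 2 * 1) := by gcongr
    _ = _ := by ring

/-- Smooth functions of the longitudinal variable with bounded support. -/
structure IsLineTest (v : ℝ → ℝ) : Prop where
  contDiff : ContDiff ℝ (⊤ : ℕ∞) v
  bounded : ∃ R, ∀ s, R ≤ |s| → v s = 0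

/-- Smooth real functions compactly supported in the strip of half-width one. -/
structure IsStripTest (u : ℝ → ℝ → ℝ) : Prop where
  contDiff : ContDiff ℝ (⊤ : ℕ∞) fun p : ℝ × ℝ => u p.1 p.2
  transverse : ∃ r < 1, ∀ s t, r ≤ |t| → u s t = 0
  longitudinal : ∃ R, ∀ s t, R ≤ |s| → u s t = 0

/-- The geodesic Hardy inequality on the strip of half-width one, for real test functions. -/
def GeoHardy (α c s₀ : ℝ) (q : ℝ → ℝ) : Prop :=
  ∀ u : ℝ → ℝ → ℝ, IsStripTest u →
    c * ∫ s, (1 + (s - s₀) ^ 2)⁻¹ * ∫ t in (-1 : ℝ)..1, geoWeight (q s) t * u s t ^ 2 ≤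
    ∫ s, (α * (∫ t in (-1 : ℝ)..1, (geoWeight (q s) t)⁻¹ * deriv (fun x => u x t) s ^ 2) +
      ∫ t in (-1 : ℝ)..1, geoWeight (q s) t * (deriv (u s) t ^ 2 - π ^ 2 / 4 * u s t ^ 2))

lemma integrable_of_continuous_of_bounded {F : ℝ → ℝ} (hF : Continuous F)
    (hb : ∃ R, ∀ s, R ≤ |s| → F s = 0) : Integrable F := by
  obtain ⟨R, hR⟩ := hb
  apply hF.integrable_of_hasCompactSupport
  refine HasCompactSupport.intro (isCompact_Icc (a := -R) (b := R)) fun s hs => hR s ?_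
  by_contra h
  exact hs (abs_le.1 (not_le.1 h).le)

lemma continuous_integral_of_continuous {F : ℝ → ℝ → ℝ}
    (hF : Continuous fun p : ℝ × ℝ => F p.1 p.2) :
    Continuous fun s => ∫ t in (-1 : ℝ)..1, F s t :=
  intervalIntegral.continuous_parametric_intervalIntegral_of_continuous' hF _ _

lemma continuous_inv_one_add_sub_sq (s₀ : ℝ) : Continuous fun s : ℝ => (1 + (s - s₀) ^ 2)⁻¹ :=
  Continuous.inv₀ (by fun_prop) fun s => by positivity

lemma continuous_modeMass_comp {q : ℝ → ℝ} (hq : Continuous q) :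
    Continuous fun s => modeMass (q s) :=
  continuous_integral_of_continuous (by fun_prop)

lemma continuous_geoSlope_comp {q : ℝ → ℝ} (hq : Continuous q) (hq0 : ∀ s, 0 ≤ q s) :
    Continuous fun p : ℝ × ℝ => geoSlope (q p.1) p.2 := by
  unfold geoSlope
  exact Continuous.div (by fun_prop) (by fun_prop) fun p => (geoWeight_pos (hq0 p.1) p.2).ne'

lemma continuous_inv_geoWeight_comp {q : ℝ → ℝ} (hq : Continuous q) (hq0 : ∀ s, 0 ≤ q s) :
    Continuous fun p : ℝ × ℝ => (geoWeight (q p.1) p.2)⁻¹ :=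
  Continuous.inv₀ (by fun_prop) fun p => (geoWeight_pos (hq0 p.1) p.2).ne'

lemma continuous_modePotential_comp {q : ℝ → ℝ} (hq : Continuous q) (hq0 : ∀ s, 0 ≤ q s) :
    Continuous fun s => modePotential (q s) := by
  have := continuous_geoSlope_comp hq hq0
  exact continuous_integral_of_continuous (by fun_prop)

lemma IsLineTest.continuous {v : ℝ → ℝ} (hv : IsLineTest v) : Continuous v :=
  hv.contDiff.continuous

lemma IsLineTest.continuous_deriv {v : ℝ → ℝ} (hv : IsLineTest v) : Continuous (deriv v) :=
  hv.contDiff.continuous_deriv (by norm_cast)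

lemma deriv_eq_zero_of_eventually_zero {v : ℝ → ℝ} {R s : ℝ} (hR : ∀ s, R ≤ |s| → v s = 0)
    (hs : R + 1 ≤ |s|) : deriv v s = 0 := by
  have : v =ᶠ[𝓝 s] fun _ => 0 := by
    filter_upwards [continuous_abs.continuousAt.eventually_const_lt
      (show R < |s| by linarith)] with y hy
    exact hR y hy.le
  rw [this.deriv_eq, deriv_const]

lemma IsLineTest.deriv_bounded {v : ℝ → ℝ} (hv : IsLineTest v) :
    ∃ R, ∀ s, R ≤ |s| → v s = 0 ∧ deriv v s = 0 := by
  obtain ⟨R, hR⟩ := hv.bounded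
  exact ⟨R + 1, fun s hs => ⟨hR s (by linarith), deriv_eq_zero_of_eventually_zero hR hs⟩⟩

lemma le_of_forall_pos_le_add_mul {X Y K : ℝ} (h : ∀ ε > 0, X ≤ Y + ε * K) : X ≤ Y := by
  apply le_of_forall_pos_le_add
  intro δ hδ
  refine (h (δ / (|K| + 1)) (by positivity)).trans ?_
  gcongr
  rw [div_mul_eq_mul_div, div_le_iff₀ (by positivity)]
  nlinarith [le_abs_self K]

/-- The geodesic Hardy inequality projected onto the transverse ground state. -/
lemma GeoHardy.mode {α c s₀ : ℝ} {q : ℝ → ℝ} (h : GeoHardy α c s₀ q) (hα : 0 ≤ α) (hc : 0 ≤ c)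
    (hq : Continuous q) (hq0 : ∀ s, 0 ≤ q s) (hq2 : ∀ s, q s ≤ 2) {v : ℝ → ℝ}
    (hv : IsLineTest v) :
    c * ∫ s, (1 + (s - s₀) ^ 2)⁻¹ * (modeMass (q s) * v s ^ 2) ≤
      ∫ s, (α * deriv v s ^ 2 + modePotential (q s) * v s ^ 2) := by
  have hvc := hv.continuous
  have hvd := hv.continuous_deriv
  have hρ := continuous_inv_one_add_sub_sq s₀
  have hN := continuous_modeMass_comp hq
  have hτ := continuous_modePotential_comp hq hq0
  obtain ⟨R, hR⟩ := hv.deriv_bounded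
  have hFint : ∀ F : ℝ → ℝ, Continuous F → (∀ s, v s = 0 → deriv v s = 0 → F s = 0) →
      Integrable F := fun F hF h0 =>
    integrable_of_continuous_of_bounded hF ⟨R, fun s hs => h0 s (hR s hs).1 (hR s hs).2⟩
  apply le_of_forall_pos_le_add_mul (K := 2 * (∫ s, v s ^ 2) +
    2 * c * ∫ s, (1 + (s - s₀) ^ 2)⁻¹ * v s ^ 2)
  intro ε hε
  obtain ⟨J, hJ, ⟨r, hr, hJr⟩, hJ0, hJ1, hJm, hJd⟩ := exists_cutoff hε
  have hJc := hJ.continuous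
  have hJdc : Continuous (deriv J) := hJ.continuous_deriv (by norm_cast)
  have hJh : ∀ t, HasDerivAt J (deriv J t) t := fun t =>
    (hJ.differentiable (by simp) t).hasDerivAt
  have htest : IsStripTest fun s t => v s * (cos (π / 2 * t) * J t) := by
    refine ⟨?_, ⟨r, hr, fun s t ht => by simp [hJr t ht]⟩,
      ⟨R, fun s t hs => by simp [(hR s hs).1]⟩⟩
    have h1 : ContDiff ℝ (⊤ : ℕ∞) fun p : ℝ × ℝ => v p.1 := hv.contDiff.comp contDiff_fst
    have h2 : ContDiff ℝ (⊤ : ℕ∞) fun p : ℝ × ℝ => J p.2 := hJ.comp contDiff_snd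
    have h3 : ContDiff ℝ (⊤ : ℕ∞) fun p : ℝ × ℝ => cos (π / 2 * p.2) := by fun_prop
    exact h1.mul (h3.mul h2)
  have key := h _ htest
  have d1 : ∀ s t, deriv (fun x => v x * (cos (π / 2 * t) * J t)) s =
      deriv v s * (cos (π / 2 * t) * J t) := fun s t =>
    ((hv.contDiff.differentiable (by simp) s).hasDerivAt.mul_const _).deriv
  have d2 : ∀ s t, deriv (fun t => v s * (cos (π / 2 * t) * J t)) t =
      v s * (-(π / 2 * sin (π / 2 * t)) * J t + cos (π / 2 * t) * deriv J t) := fun s t =>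
    (((hasDerivAt_cos_half_pi_mul t).fun_mul (hJh t)).const_mul (v s)).deriv
  have e1 : ∀ s t, geoWeight (q s) t * (v s * (cos (π / 2 * t) * J t)) ^ 2 =
      v s ^ 2 * (geoWeight (q s) t * (cos (π / 2 * t) * J t) ^ 2) := fun s t => by ring
  have e2 : ∀ s t, (geoWeight (q s) t)⁻¹ * (deriv v s * (cos (π / 2 * t) * J t)) ^ 2 =
      deriv v s ^ 2 * ((geoWeight (q s) t)⁻¹ * (cos (π / 2 * t) * J t) ^ 2) := fun s t => by ring
  have e3 : ∀ s t, geoWeight (q s) t * ((v s * (-(π / 2 * sin (π / 2 * t)) * J t +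
      cos (π / 2 * t) * deriv J t)) ^ 2 - π ^ 2 / 4 * (v s * (cos (π / 2 * t) * J t)) ^ 2) =
      v s ^ 2 * (geoWeight (q s) t * ((-(π / 2 * sin (π / 2 * t)) * J t +
      cos (π / 2 * t) * deriv J t) ^ 2 - π ^ 2 / 4 * (cos (π / 2 * t) * J t) ^ 2)) :=
    fun s t => by ring
  simp_rw [d1, d2, e1, e2, e3, intervalIntegral.integral_const_mul] at key
  have hic := continuous_inv_geoWeight_comp hq hq0
  have c1 : Continuous fun s => ∫ t in (-1 : ℝ)..1,
      geoWeight (q s) t * (cos (π / 2 * t) * J t) ^ 2 :=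
    continuous_integral_of_continuous (by fun_prop)
  have c2 : Continuous fun s => ∫ t in (-1 : ℝ)..1,
      (geoWeight (q s) t)⁻¹ * (cos (π / 2 * t) * J t) ^ 2 :=
    continuous_integral_of_continuous (by fun_prop)
  have c3 : Continuous fun s => ∫ t in (-1 : ℝ)..1,
      geoWeight (q s) t * ((-(π / 2 * sin (π / 2 * t)) * J t +
      cos (π / 2 * t) * deriv J t) ^ 2 - π ^ 2 / 4 * (cos (π / 2 * t) * J t) ^ 2) :=
    continuous_integral_of_continuous (by fun_prop)
  have u1 : (∫ s, (α * (deriv v s ^ 2 * ∫ t in (-1 : ℝ)..1,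
      (geoWeight (q s) t)⁻¹ * (cos (π / 2 * t) * J t) ^ 2) +
      v s ^ 2 * ∫ t in (-1 : ℝ)..1, geoWeight (q s) t * ((-(π / 2 * sin (π / 2 * t)) * J t +
      cos (π / 2 * t) * deriv J t) ^ 2 - π ^ 2 / 4 * (cos (π / 2 * t) * J t) ^ 2))) ≤
      ∫ s, ((α * deriv v s ^ 2 + modePotential (q s) * v s ^ 2) + 2 * ε * v s ^ 2) := by
    apply integral_mono (hFint _ (by fun_prop) fun s h1 h2 => by simp [h1, h2])
      (hFint _ (by fun_prop) fun s h1 h2 => by simp [h1, h2])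
    intro s
    have i1 := mul_le_mul_of_nonneg_left (mul_le_mul_of_nonneg_left
      (trial_kinetic_le (hq0 s) hJc hJ0 hJ1) (sq_nonneg (deriv v s))) hα
    have i2 := mul_le_mul_of_nonneg_left
      (trial_transverse_le (hq0 s) (hq2 s) hJ hJ0 hJ1 hJd) (sq_nonneg (v s))
    dsimp only
    linarith
  have l1 : (∫ s, ((1 + (s - s₀) ^ 2)⁻¹ * (modeMass (q s) * v s ^ 2) -
      2 * ε * ((1 + (s - s₀) ^ 2)⁻¹ * v s ^ 2))) ≤
      ∫ s, (1 + (s - s₀) ^ 2)⁻¹ * (v s ^ 2 * ∫ t in (-1 : ℝ)..1,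
        geoWeight (q s) t * (cos (π / 2 * t) * J t) ^ 2) := by
    apply integral_mono (hFint _ (by fun_prop) fun s h1 h2 => by simp [h1])
      (hFint _ (by fun_prop) fun s h1 h2 => by simp [h1])
    intro s
    have i1 := mul_le_mul_of_nonneg_left (mul_le_mul_of_nonneg_left
      (trial_mass_ge (hq0 s) (hq2 s) hJc hJ0 hJ1 hJm) (sq_nonneg (v s)))
      (by positivity : 0 ≤ (1 + (s - s₀) ^ 2)⁻¹)
    dsimp only
    linarith
  rw [integral_sub (hFint _ (by fun_prop) fun s h1 h2 => by simp [h1])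
      (hFint _ (by fun_prop) fun s h1 h2 => by simp [h1]), integral_const_mul] at l1
  have u2 : (∫ s, ((α * deriv v s ^ 2 + modePotential (q s) * v s ^ 2) + 2 * ε * v s ^ 2)) =
      (∫ s, (α * deriv v s ^ 2 + modePotential (q s) * v s ^ 2)) + 2 * ε * ∫ s, v s ^ 2 := by
    rw [integral_add (hFint _ (by fun_prop) fun s h1 h2 => by simp [h1, h2])
      (hFint _ (by fun_prop) fun s h1 h2 => by simp [h1]), integral_const_mul]
  rw [u2] at u1
  have l2 := mul_le_mul_of_nonneg_left l1 hc
  linarith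

lemma inv_one_add_sq_le_one (x : ℝ) : (1 + x ^ 2)⁻¹ ≤ 1 :=
  inv_le_one_of_one_le₀ (by nlinarith [sq_nonneg x])

/-- The convolution of two Cauchy densities. -/
lemma integral_inv_mul_inv_one_add_sq {z : ℝ} (hz : z ≠ 0) :
    ∫ x : ℝ, (1 + x ^ 2)⁻¹ * (1 + (x - z) ^ 2)⁻¹ = 2 * π / (4 + z ^ 2) := by
  let F : ℝ → ℝ := fun x =>
    (z⁻¹ * log ((1 + x ^ 2) / (1 + (x - z) ^ 2)) + arctan x + arctan (x - z)) / (4 + z ^ 2)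
  have hF : ∀ x, HasDerivAt F ((1 + x ^ 2)⁻¹ * (1 + (x - z) ^ 2)⁻¹) x := by
    intro x
    have p1 : 0 < 1 + x ^ 2 := by positivity
    have p2 : 0 < 1 + (x - z) ^ 2 := by positivity
    have p3 : 0 < 4 + z ^ 2 := by positivity
    have h1 : HasDerivAt (fun x : ℝ => 1 + x ^ 2) (2 * x) x :=
      ((hasDerivAt_id x).fun_pow 2).const_add 1 |>.congr_deriv (by simp)
    have h2 : HasDerivAt (fun x : ℝ => 1 + (x - z) ^ 2) (2 * (x - z)) x :=
      ((((hasDerivAt_id x).sub_const z).fun_pow 2).const_add 1).congr_deriv (by simp)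
    have h3 := (h1.fun_div h2 p2.ne').log (div_pos p1 p2).ne'
    have h4 := ((hasDerivAt_id x).sub_const z).arctan
    refine ((((h3.const_mul z⁻¹).add (hasDerivAt_arctan x)).add h4).div_const
      (4 + z ^ 2)).congr_deriv ?_
    simp only [id]
    field_simp
    ring
  have hlim : ∀ (l : Filter ℝ) (A : ℝ), Tendsto (fun x : ℝ => x⁻¹) l (𝓝 0) →
      (∀ᶠ x in l, x ≠ 0) → Tendsto arctan l (𝓝 A) →
      Tendsto (fun x => arctan (x - z)) l (𝓝 A) → Tendsto F l (𝓝 (2 * A / (4 + z ^ 2))) := by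
    intro l A hl h0 hA hA'
    have h1 : Tendsto (fun x : ℝ => (1 + x ^ 2) / (1 + (x - z) ^ 2)) l (𝓝 1) := by
      have h2 : Tendsto (fun x : ℝ => (x⁻¹ ^ 2 + 1) / (x⁻¹ ^ 2 + (1 - z * x⁻¹) ^ 2)) l
          (𝓝 ((0 ^ 2 + 1) / (0 ^ 2 + (1 - z * 0) ^ 2))) :=
        ((hl.pow 2).add_const 1).div ((hl.pow 2).add ((hl.const_mul z).const_sub 1 |>.pow 2))
          (by norm_num)
      have h3 : ((0 : ℝ) ^ 2 + 1) / (0 ^ 2 + (1 - z * 0) ^ 2) = 1 := by norm_num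
      rw [h3] at h2
      refine h2.congr' ?_
      filter_upwards [h0] with x hx
      have p2 : 0 < 1 + (x - z) ^ 2 := by positivity
      have p4 : x⁻¹ ^ 2 + (1 - z * x⁻¹) ^ 2 = (1 + (x - z) ^ 2) / x ^ 2 := by field_simp
      rw [p4]
      field_simp
    have h4 := h1.log one_ne_zero
    rw [log_one] at h4
    have h5 := (((h4.const_mul z⁻¹).add hA).add hA').div_const (4 + z ^ 2)
    convert h5 using 2
    ring
  have hFint : Integrable fun x : ℝ => (1 + x ^ 2)⁻¹ * (1 + (x - z) ^ 2)⁻¹ := by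
    refine integrable_inv_one_add_sq.mono'
      (Continuous.aestronglyMeasurable ?_) (Eventually.of_forall fun x => ?_)
    · have := continuous_inv_one_add_sub_sq z
      have h0 := continuous_inv_one_add_sub_sq 0
      simp only [sub_zero] at h0
      fun_prop
    · rw [norm_of_nonneg (by positivity)]
      exact mul_le_of_le_one_right (by positivity) (inv_one_add_sq_le_one _)
  have htop : Tendsto (fun x : ℝ => x - z) atTop atTop :=
    tendsto_atTop_add_const_right _ _ tendsto_id
  have hbot : Tendsto (fun x : ℝ => x - z) atBot atBot :=
    tendsto_atBot_add_const_right _ _ tendsto_id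
  have ht := tendsto_nhds_of_tendsto_nhdsWithin tendsto_arctan_atTop
  have hb := tendsto_nhds_of_tendsto_nhdsWithin tendsto_arctan_atBot
  rw [integral_of_hasDerivAt_of_tendsto hF hFint
    (hlim atBot _ tendsto_inv_atBot_zero (eventually_ne_atBot 0) hb (hb.comp hbot))
    (hlim atTop _ tendsto_inv_atTop_zero (eventually_ne_atTop 0) ht (ht.comp htop))]
  ring

lemma integral_comp_two_mul_sub (G : ℝ → ℝ) (z : ℝ) :
    ∫ p, G (2 * (p - z)) = 1 / 2 * ∫ x, G x := by
  rw [integral_sub_right_eq_self (fun p => G (2 * p)) z, Measure.integral_comp_mul_left G,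
    abs_of_pos (by norm_num), smul_eq_mul]
  ring

lemma integral_inv_mul_inv_one_add_four_mul_sq {y z : ℝ} (h : y ≠ z) :
    ∫ p : ℝ, (1 + 4 * (p - z) ^ 2)⁻¹ * (1 + 4 * (y - p) ^ 2)⁻¹ =
      π / 4 * (1 + (y - z) ^ 2)⁻¹ := by
  have h1 := integral_inv_mul_inv_one_add_sq (z := 2 * (y - z))
    (mul_ne_zero two_ne_zero (sub_ne_zero.2 h))
  have h2 : ∀ p : ℝ, (1 + 4 * (p - z) ^ 2)⁻¹ * (1 + 4 * (y - p) ^ 2)⁻¹ =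
      (fun x : ℝ => (1 + x ^ 2)⁻¹ * (1 + (x - 2 * (y - z)) ^ 2)⁻¹) (2 * (p - z)) := fun p => by
    dsimp only
    congr 2 <;> ring
  simp_rw [h2]
  rw [integral_comp_two_mul_sub (fun x => (1 + x ^ 2)⁻¹ * (1 + (x - 2 * (y - z)) ^ 2)⁻¹), h1]
  have : 0 < 1 + (y - z) ^ 2 := by positivity
  field_simp
  ring

lemma integral_inv_one_add_four_mul_sq (z : ℝ) :
    ∫ p : ℝ, (1 + 4 * (p - z) ^ 2)⁻¹ = π / 2 := by
  have h2 : ∀ p : ℝ, (1 + 4 * (p - z) ^ 2)⁻¹ =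
      (fun x : ℝ => (1 + x ^ 2)⁻¹) (2 * (p - z)) := fun p => by
    dsimp only
    congr 2; ring
  simp_rw [h2]
  rw [integral_comp_two_mul_sub (fun x => (1 + x ^ 2)⁻¹), integral_univ_inv_one_add_sq]
  ring

lemma integrable_inv_one_add_four_mul_sq (z : ℝ) :
    Integrable fun p : ℝ => (1 + 4 * (p - z) ^ 2)⁻¹ := by
  have h := ((integrable_inv_one_add_sq.comp_mul_left' two_ne_zero).comp_sub_right z)
  refine h.congr (Eventually.of_forall fun p => ?_)
  dsimp only
  congr 2; ring

lemma IsLineTest.rescale {w : ℝ → ℝ} (hw : IsLineTest w) (d : ℝ) :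
    IsLineTest fun s => w (2⁻¹ * s + d) := by
  obtain ⟨R, hR⟩ := hw.bounded
  refine ⟨hw.contDiff.comp (by fun_prop), 2 * (R + |d|), fun s hs => hR _ ?_⟩
  have h1 := abs_sub_abs_le_abs_sub (2⁻¹ * s) (-d)
  rw [abs_mul, abs_of_pos (by norm_num : (0 : ℝ) < 2⁻¹), abs_neg, sub_neg_eq_add] at h1
  linarith

/-- A one-dimensional Hardy inequality improves under rescaling by averaging over centres. -/
lemma line_hardy_rescale {α β c s₀ : ℝ}
    (h : ∀ v, IsLineTest v → c * ∫ s, (1 + (s - s₀) ^ 2)⁻¹ * v s ^ 2 ≤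
      α * (∫ s, deriv v s ^ 2) + β * ∫ s, v s ^ 2) {w : ℝ → ℝ} (hw : IsLineTest w) :
    c * ∫ s, (1 + (s - s₀) ^ 2)⁻¹ * w s ^ 2 ≤
      1 / 2 * α * (∫ s, deriv w s ^ 2) + 2 * β * ∫ s, w s ^ 2 := by
  have hwc := hw.continuous
  set B := 1 / 2 * α * (∫ s, deriv w s ^ 2) + 2 * β * ∫ s, w s ^ 2 with hB
  have hscale : ∀ (G : ℝ → ℝ) (d : ℝ), ∫ s, G (2⁻¹ * s + d) = 2 * ∫ y, G y := fun G d => by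
    rw [Measure.integral_comp_mul_left (fun s => G (s + d)), integral_add_right_eq_self G d]
    simp
  have hcent : ∀ p : ℝ, c * (2 * ∫ y, (1 + 4 * (y - p) ^ 2)⁻¹ * w y ^ 2) ≤ B := by
    intro p
    have h1 := h _ (hw.rescale (p - s₀ / 2))
    have hd : ∀ s, deriv (fun s => w (2⁻¹ * s + (p - s₀ / 2))) s =
        deriv w (2⁻¹ * s + (p - s₀ / 2)) * 2⁻¹ := fun s => by
      have h2 : HasDerivAt (fun s : ℝ => 2⁻¹ * s + (p - s₀ / 2)) 2⁻¹ s :=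
        ((hasDerivAt_id s).const_mul 2⁻¹).add_const _ |>.congr_deriv (by simp)
      exact ((hw.contDiff.differentiable (by simp) _).hasDerivAt.comp s h2).deriv
    simp_rw [hd, mul_pow, integral_mul_const] at h1
    rw [hscale (fun y => deriv w y ^ 2), hscale (fun y => w y ^ 2)] at h1
    have h3 : ∀ s, (1 + (s - s₀) ^ 2)⁻¹ * w (2⁻¹ * s + (p - s₀ / 2)) ^ 2 =
        (fun y => (1 + 4 * (y - p) ^ 2)⁻¹ * w y ^ 2) (2⁻¹ * s + (p - s₀ / 2)) := fun s => by
      dsimp only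
      congr 2; ring
    simp_rw [h3] at h1
    rw [hscale (fun y => (1 + 4 * (y - p) ^ 2)⁻¹ * w y ^ 2)] at h1
    linarith
  have hk1 : Continuous fun x : ℝ × ℝ => (1 + 4 * (x.1 - s₀) ^ 2)⁻¹ :=
    Continuous.inv₀ (by fun_prop) fun x => by positivity
  have hk2 : Continuous fun x : ℝ × ℝ => (1 + 4 * (x.2 - x.1) ^ 2)⁻¹ :=
    Continuous.inv₀ (by fun_prop) fun x => by positivity
  have hw2 : Integrable fun y => w y ^ 2 :=
    integrable_of_continuous_of_bounded (by fun_prop)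
      (hw.bounded.imp fun R hR s hs => by simp [hR s hs])
  have hFint : Integrable (Function.uncurry fun p y => (1 + 4 * (p - s₀) ^ 2)⁻¹ *
      ((1 + 4 * (y - p) ^ 2)⁻¹ * w y ^ 2)) (volume.prod volume) := by
    refine ((integrable_inv_one_add_four_mul_sq s₀).mul_prod hw2).mono'
      (Continuous.aestronglyMeasurable ?_) (Eventually.of_forall fun x => ?_)
    · simp only [Function.uncurry_def]
      fun_prop
    · simp only [Function.uncurry_def]
      rw [norm_of_nonneg (by positivity)]
      have : (1 + 4 * (x.2 - x.1) ^ 2)⁻¹ ≤ 1 :=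
        inv_le_one_of_one_le₀ (by nlinarith [sq_nonneg (x.2 - x.1)])
      gcongr
      exact mul_le_of_le_one_left (sq_nonneg _) this
  have hswap := integral_integral_swap hFint
  have hin : ∀ᵐ y : ℝ, (∫ p, (1 + 4 * (p - s₀) ^ 2)⁻¹ *
      ((1 + 4 * (y - p) ^ 2)⁻¹ * w y ^ 2)) = π / 4 * ((1 + (y - s₀) ^ 2)⁻¹ * w y ^ 2) := by
    filter_upwards [Measure.ae_ne volume s₀] with y hy
    simp_rw [← mul_assoc]
    rw [integral_mul_const, integral_inv_mul_inv_one_add_four_mul_sq hy]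
  rw [integral_congr_ae hin, integral_const_mul] at hswap
  have hmono : (∫ p, 2 * c * ∫ y, (1 + 4 * (p - s₀) ^ 2)⁻¹ *
      ((1 + 4 * (y - p) ^ 2)⁻¹ * w y ^ 2)) ≤ ∫ p, (1 + 4 * (p - s₀) ^ 2)⁻¹ * B := by
    refine integral_mono ?_ ((integrable_inv_one_add_four_mul_sq s₀).mul_const B) fun p => ?_
    · exact (hFint.integral_prod_left).const_mul _
    · dsimp only
      rw [integral_const_mul]
      have := mul_le_mul_of_nonneg_left (hcent p)
        (by positivity : 0 ≤ (1 + 4 * (p - s₀) ^ 2)⁻¹)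
      linarith
  rw [integral_const_mul, hswap, integral_mul_const, integral_inv_one_add_four_mul_sq] at hmono
  have hpi := pi_pos
  have : π / 2 * (c * ∫ s, (1 + (s - s₀) ^ 2)⁻¹ * w s ^ 2) ≤ π / 2 * B := by linarith
  exact le_of_mul_le_mul_left this (by positivity)

/-- The rescaled one-dimensional Hardy inequality implied by the geodesic one. -/
lemma GeoHardy.line {α c s₀ : ℝ} {q : ℝ → ℝ} (h : GeoHardy α c s₀ q) (hα : 0 ≤ α) (hc : 0 ≤ c)
    (hq : Continuous q) (hq0 : ∀ s, 0 ≤ q s) (hq2 : ∀ s, q s ≤ 2) {w : ℝ → ℝ}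
    (hw : IsLineTest w) :
    c * ∫ s, (1 + (s - s₀) ^ 2)⁻¹ * w s ^ 2 ≤
      1 / 2 * α * (∫ s, deriv w s ^ 2) + 1.64 * ∫ s, w s ^ 2 := by
  have h1 := line_hardy_rescale (α := α) (β := 0.82) (c := c) (s₀ := s₀) (fun v hv => ?_) hw
  · convert h1 using 2
    norm_num
  have hvc := hv.continuous
  have hvd := hv.continuous_deriv
  have hρ := continuous_inv_one_add_sub_sq s₀
  have hN := continuous_modeMass_comp hq
  have hτ := continuous_modePotential_comp hq hq0
  obtain ⟨R, hR⟩ := hv.deriv_bounded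
  have hFint : ∀ F : ℝ → ℝ, Continuous F → (∀ s, v s = 0 → deriv v s = 0 → F s = 0) →
      Integrable F := fun F hF h0 =>
    integrable_of_continuous_of_bounded hF ⟨R, fun s hs => h0 s (hR s hs).1 (hR s hs).2⟩
  calc c * ∫ s, (1 + (s - s₀) ^ 2)⁻¹ * v s ^ 2
      ≤ c * ∫ s, (1 + (s - s₀) ^ 2)⁻¹ * (modeMass (q s) * v s ^ 2) := by
        refine mul_le_mul_of_nonneg_left (integral_mono
          (hFint _ (by fun_prop) fun s h1 h2 => by simp [h1])
          (hFint _ (by fun_prop) fun s h1 h2 => by simp [h1]) fun s => ?_) hc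
        have := one_le_modeMass (hq0 s)
        dsimp only
        gcongr
        exact le_mul_of_one_le_left (sq_nonneg _) this
    _ ≤ ∫ s, (α * deriv v s ^ 2 + modePotential (q s) * v s ^ 2) :=
        h.mode hα hc hq hq0 hq2 hv
    _ ≤ ∫ s, (α * deriv v s ^ 2 + 0.82 * v s ^ 2) := by
        refine integral_mono (hFint _ (by fun_prop) fun s h1 h2 => by simp [h1, h2])
          (hFint _ (by fun_prop) fun s h1 h2 => by simp [h1, h2]) fun s => ?_
        have := modePotential_le (hq0 s) (hq2 s)
        dsimp only
        gcongr
    _ = _ := by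
        rw [integral_add (hFint _ (by fun_prop) fun s h1 h2 => by simp [h2])
          (hFint _ (by fun_prop) fun s h1 h2 => by simp [h1]), integral_const_mul,
          integral_const_mul]

namespace IsStripTest

variable {u : ℝ → ℝ → ℝ}

lemma contDiff_slice_fst (hu : IsStripTest u) (t : ℝ) : ContDiff ℝ (⊤ : ℕ∞) fun s => u s t :=
  hu.contDiff.comp (contDiff_id.prodMk contDiff_const)

lemma contDiff_slice_snd (hu : IsStripTest u) (s : ℝ) : ContDiff ℝ (⊤ : ℕ∞) (u s) :=
  hu.contDiff.comp (contDiff_const.prodMk contDiff_id)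

lemma hasDerivAt_fst (hu : IsStripTest u) (s t : ℝ) :
    HasDerivAt (fun x => u x t) (deriv (fun x => u x t) s) s :=
  ((hu.contDiff_slice_fst t).differentiable (by simp) s).hasDerivAt

lemma hasDerivAt_snd (hu : IsStripTest u) (s t : ℝ) : HasDerivAt (u s) (deriv (u s) t) t :=
  ((hu.contDiff_slice_snd s).differentiable (by simp) t).hasDerivAt

lemma continuous (hu : IsStripTest u) : Continuous fun p : ℝ × ℝ => u p.1 p.2 :=
  hu.contDiff.continuous

lemma contDiff_fderiv_apply (hu : IsStripTest u) (e : ℝ × ℝ) :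
    ContDiff ℝ (⊤ : ℕ∞) fun p => fderiv ℝ (fun p : ℝ × ℝ => u p.1 p.2) p e :=
  (hu.contDiff.fderiv_right (by norm_cast)).clm_apply contDiff_const

/-- Longitudinal derivatives of test functions are test functions. -/
lemma deriv_fst (hu : IsStripTest u) : IsStripTest fun s t => deriv (fun x => u x t) s := by
  refine ⟨?_, ?_, ?_⟩
  · convert hu.contDiff_fderiv_apply (1, 0) using 2 with p
    have h1 : HasDerivAt (fun x : ℝ => (x, p.2)) (1, 0) p.1 :=
      (hasDerivAt_id p.1).prodMk (hasDerivAt_const _ _)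
    exact ((hu.contDiff.differentiable (by simp) p).hasFDerivAt.comp_hasDerivAt p.1 h1).deriv
  · obtain ⟨r, hr, h⟩ := hu.transverse
    exact ⟨r, hr, fun s t ht => by simp [h _ t ht]⟩
  · obtain ⟨R, h⟩ := hu.longitudinal
    exact ⟨R + 1, fun s t hs => deriv_eq_zero_of_eventually_zero (fun s hs => h s t hs) hs⟩

lemma continuous_deriv_fst (hu : IsStripTest u) :
    Continuous fun p : ℝ × ℝ => deriv (fun x => u x p.2) p.1 :=
  hu.deriv_fst.continuous

lemma continuous_deriv_snd (hu : IsStripTest u) :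
    Continuous fun p : ℝ × ℝ => deriv (u p.1) p.2 := by
  refine (hu.contDiff_fderiv_apply (0, 1)).continuous.congr fun p => Eq.symm ?_
  have h1 : HasDerivAt (fun x : ℝ => (p.1, x)) (0, 1) p.2 :=
    (hasDerivAt_const _ _).prodMk (hasDerivAt_id p.2)
  exact ((hu.contDiff.differentiable (by simp) p).hasFDerivAt.comp_hasDerivAt p.2 h1).deriv

lemma exists_bound (hu : IsStripTest u) : ∃ C, ∀ s t, |u s t| ≤ C := by
  obtain ⟨r, hr, hr0⟩ := hu.transverse
  obtain ⟨R, hR0⟩ := hu.longitudinal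
  obtain ⟨C, hC⟩ := (isCompact_Icc (a := -R) (b := R)).prod (isCompact_Icc (a := -r) (b := r))
    |>.exists_bound_of_continuousOn hu.continuous.continuousOn
  refine ⟨max C 0, fun s t => ?_⟩
  by_cases hs : R ≤ |s|
  · simp [hR0 s t hs]
  by_cases ht : r ≤ |t|
  · simp [hr0 s t ht]
  · exact le_max_of_le_left (hC (s, t) ⟨abs_le.1 (not_le.1 hs).le, abs_le.1 (not_le.1 ht).le⟩)

end IsStripTest

/-- The transverse ground-state coefficient of a function on the strip. -/
noncomputable def modeCoeff (u : ℝ → ℝ → ℝ) (s : ℝ) : ℝ :=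
  ∫ t in (-1 : ℝ)..1, cos (π / 2 * t) * u s t

lemma IsStripTest.hasDerivAt_modeCoeff {u : ℝ → ℝ → ℝ} (hu : IsStripTest u) (s : ℝ) :
    HasDerivAt (modeCoeff u) (modeCoeff (fun s t => deriv (fun x => u x t) s) s) s := by
  obtain ⟨C, hC⟩ := hu.deriv_fst.exists_bound
  have hc := fun s => (hu.contDiff_slice_snd s).continuous
  have hd := fun s => (hu.deriv_fst.contDiff_slice_snd s).continuous
  refine (intervalIntegral.hasDerivAt_integral_of_dominated_loc_of_deriv_le
    (F' := fun s t => cos (π / 2 * t) * deriv (fun x => u x t) s) (bound := fun _ => C)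
    univ_mem ?_ ?_ ?_ ?_ ?_ ?_).2
  · exact Eventually.of_forall fun s =>
      (by have := hc s; fun_prop : Continuous _).aestronglyMeasurable
  · exact (by have := hc s; fun_prop : Continuous _).intervalIntegrable _ _
  · exact (by have := hd s; fun_prop : Continuous _).aestronglyMeasurable
  · refine Eventually.of_forall fun t _ x _ => ?_
    rw [norm_mul, Real.norm_eq_abs, Real.norm_eq_abs]
    exact (mul_le_of_le_one_left (abs_nonneg _) (abs_cos_le_one _)).trans (hC x t)
  · simp
  · exact Eventually.of_forall fun t _ x _ => (hu.hasDerivAt_fst x t).const_mul _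

lemma IsStripTest.deriv_modeCoeff {u : ℝ → ℝ → ℝ} (hu : IsStripTest u) :
    deriv (modeCoeff u) = modeCoeff fun s t => deriv (fun x => u x t) s :=
  funext fun s => (hu.hasDerivAt_modeCoeff s).deriv

lemma IsStripTest.isLineTest_modeCoeff {u : ℝ → ℝ → ℝ} (hu : IsStripTest u) :
    IsLineTest (modeCoeff u) := by
  refine ⟨contDiff_infty.2 fun n => ?_, ?_⟩
  · induction n generalizing u with
    | zero => exact contDiff_zero.2 (Differentiable.continuous (𝕜 := ℝ) fun s =>
        (hu.hasDerivAt_modeCoeff s).differentiableAt)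
    | succ n ih =>
      push_cast
      refine contDiff_succ_iff_deriv.2
        ⟨fun s => (hu.hasDerivAt_modeCoeff s).differentiableAt, by simp, ?_⟩
      rw [hu.deriv_modeCoeff]
      exact ih hu.deriv_fst
  · obtain ⟨R, hR⟩ := hu.longitudinal
    exact ⟨R, fun s hs => by simp [modeCoeff, hR s _ hs]⟩

lemma intervalIntegral_integral_swap_of_continuous {F : ℝ → ℝ → ℝ}
    (hF : Continuous fun p : ℝ × ℝ => F p.1 p.2) {R : ℝ} (hR : ∀ s t, R ≤ |s| → F s t = 0) :
    ∫ t in (-1 : ℝ)..1, ∫ s, F s t = ∫ s, ∫ t in (-1 : ℝ)..1, F s t := by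
  apply intervalIntegral_integral_swap (f := fun t s => F s t)
  have h1 : IntegrableOn (fun p : ℝ × ℝ => F p.2 p.1) (Icc (-1) 1 ×ˢ Icc (-R) R) :=
    ((by fun_prop : Continuous fun p : ℝ × ℝ => F p.2 p.1).continuousOn.integrableOn_compact
      (isCompact_Icc.prod isCompact_Icc))
  have h2 : IntegrableOn (fun p : ℝ × ℝ => F p.2 p.1) (Icc (-1) 1 ×ˢ univ) := by
    refine h1.of_forall_sdiff_eq_zero (measurableSet_Icc.prod .univ) fun p hp => ?_
    apply hR
    by_contra h
    exact hp.2 ⟨hp.1.1, abs_le.1 (not_le.1 h).le⟩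
  rw [uIoc_of_le (by norm_num)]
  have h3 := h2.mono_set (prod_mono_left (Ioc_subset_Icc_self (a := (-1 : ℝ)) (b := 1)) (t := univ))
  rwa [IntegrableOn, Measure.volume_eq_prod, ← Measure.prod_restrict, Measure.restrict_univ] at h3

lemma integral_sub_mode_sq {f : ℝ → ℝ} (hf : Continuous f) :
    ∫ t in (-1 : ℝ)..1, (f t - (∫ t in (-1 : ℝ)..1, cos (π / 2 * t) * f t) * cos (π / 2 * t)) ^ 2 =
      (∫ t in (-1 : ℝ)..1, f t ^ 2) - (∫ t in (-1 : ℝ)..1, cos (π / 2 * t) * f t) ^ 2 := by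
  set A := ∫ t in (-1 : ℝ)..1, cos (π / 2 * t) * f t with hA
  have h1 : ∀ t, (f t - A * cos (π / 2 * t)) ^ 2 = (f t ^ 2 - 2 * A * (cos (π / 2 * t) * f t)) +
      A ^ 2 * cos (π / 2 * t) ^ 2 := fun t => by ring
  simp_rw [h1]
  rw [intervalIntegral.integral_add ((by fun_prop : Continuous _).intervalIntegrable _ _)
    ((by fun_prop : Continuous _).intervalIntegrable _ _),
    intervalIntegral.integral_sub ((by fun_prop : Continuous _).intervalIntegrable _ _)
    ((by fun_prop : Continuous _).intervalIntegrable _ _), intervalIntegral.integral_const_mul,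
    intervalIntegral.integral_const_mul, integral_cos_half_pi_mul_sq, ← hA]
  ring

/-- Hardy inequality on the orthogonal complement of the transverse ground state. -/
lemma GeoHardy.orthogonal {α c s₀ : ℝ} {q : ℝ → ℝ} (h : GeoHardy α c s₀ q) (hα : 0 ≤ α)
    (hc : 0 ≤ c) (hq : Continuous q) (hq0 : ∀ s, 0 ≤ q s) (hq2 : ∀ s, q s ≤ 2)
    {u : ℝ → ℝ → ℝ} (hu : IsStripTest u) :
    0 ≤ ∫ s, (1 / 2 * α * ((∫ t in (-1 : ℝ)..1, deriv (fun x => u x t) s ^ 2) -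
        deriv (modeCoeff u) s ^ 2) +
      (1.64 - c * (1 + (s - s₀) ^ 2)⁻¹) *
        ((∫ t in (-1 : ℝ)..1, u s t ^ 2) - modeCoeff u s ^ 2)) := by
  have hv := hu.isLineTest_modeCoeff
  have hvc := hv.continuous
  have hvd := hv.continuous_deriv
  have huc := hu.continuous
  have hud := hu.continuous_deriv_fst
  have hρ := continuous_inv_one_add_sub_sq s₀
  obtain ⟨R, hR⟩ := hv.deriv_bounded
  obtain ⟨R₁, hR₁⟩ := hu.longitudinal
  obtain ⟨R₂, hR₂⟩ := hu.deriv_fst.longitudinal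
  set G : ℝ → ℝ → ℝ := fun s t =>
    1 / 2 * α * (deriv (fun x => u x t) s - deriv (modeCoeff u) s * cos (π / 2 * t)) ^ 2 +
      (1.64 - c * (1 + (s - s₀) ^ 2)⁻¹) * (u s t - modeCoeff u s * cos (π / 2 * t)) ^ 2 with hG
  have hGc : Continuous fun p : ℝ × ℝ => G p.1 p.2 := by
    have h1 := hvc.comp (continuous_fst (X := ℝ) (Y := ℝ))
    have h2 := hvd.comp (continuous_fst (X := ℝ) (Y := ℝ))
    have h3 := hρ.comp (continuous_fst (X := ℝ) (Y := ℝ))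
    have h4 : Continuous fun p : ℝ × ℝ => cos (π / 2 * p.2) := by fun_prop
    exact (continuous_const.mul ((hud.sub (h2.mul h4)).pow 2)).add
      ((continuous_const.sub (continuous_const.mul h3)).mul ((huc.sub (h1.mul h4)).pow 2))
  have hGR : ∀ s t, max R (max R₁ R₂) ≤ |s| → G s t = 0 := fun s t hs => by
    obtain ⟨h1, h2, h3⟩ : R ≤ |s| ∧ R₁ ≤ |s| ∧ R₂ ≤ |s| := by simpa using hs
    simp [hG, hR s h1, hR₁ s t h2, hR₂ s t h3]
  have hGs : ∀ s, ∫ t in (-1 : ℝ)..1, G s t =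
      1 / 2 * α * ((∫ t in (-1 : ℝ)..1, deriv (fun x => u x t) s ^ 2) -
        deriv (modeCoeff u) s ^ 2) +
      (1.64 - c * (1 + (s - s₀) ^ 2)⁻¹) *
        ((∫ t in (-1 : ℝ)..1, u s t ^ 2) - modeCoeff u s ^ 2) := fun s => by
    have c1 := (hu.contDiff_slice_snd s).continuous
    have c2 := (hu.deriv_fst.contDiff_slice_snd s).continuous
    rw [hG, intervalIntegral.integral_add ((by fun_prop : Continuous _).intervalIntegrable _ _)
      ((by fun_prop : Continuous _).intervalIntegrable _ _), intervalIntegral.integral_const_mul,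
      intervalIntegral.integral_const_mul, hu.deriv_modeCoeff]
    simp only [modeCoeff]
    rw [integral_sub_mode_sq c1, integral_sub_mode_sq c2]
  simp_rw [← hGs]
  rw [← intervalIntegral_integral_swap_of_continuous hGc hGR]
  refine intervalIntegral.integral_nonneg (by norm_num) fun t _ => ?_
  have ht : IsLineTest fun s => u s t - modeCoeff u s * cos (π / 2 * t) := by
    obtain ⟨R, hR⟩ := hv.bounded
    refine ⟨(hu.contDiff_slice_fst t).sub (hv.contDiff.mul contDiff_const),
      max R R₁, fun s hs => ?_⟩
    obtain ⟨h1, h2⟩ : R ≤ |s| ∧ R₁ ≤ |s| := by simpa using hs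
    simp [hR s h1, hR₁ s t h2]
  have key := h.line hα hc hq hq0 hq2 ht
  have hd : ∀ s, deriv (fun s => u s t - modeCoeff u s * cos (π / 2 * t)) s =
      deriv (fun x => u x t) s - deriv (modeCoeff u) s * cos (π / 2 * t) := fun s =>
    ((hu.hasDerivAt_fst s t).sub ((hu.hasDerivAt_modeCoeff s).differentiableAt.hasDerivAt.mul_const
      _)).deriv
  have hcd := ht.continuous_deriv
  have hcc := ht.continuous
  obtain ⟨R₃, hR₃⟩ := ht.deriv_bounded
  have i1 : Integrable fun s => deriv (fun s => u s t - modeCoeff u s * cos (π / 2 * t)) s ^ 2 :=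
    integrable_of_continuous_of_bounded (by fun_prop) ⟨R₃, fun s hs => by simp [(hR₃ s hs).2]⟩
  have i2 : Integrable fun s => (u s t - modeCoeff u s * cos (π / 2 * t)) ^ 2 :=
    integrable_of_continuous_of_bounded (by fun_prop) ⟨R₃, fun s hs => by simp [(hR₃ s hs).1]⟩
  have i3 : Integrable fun s => (1 + (s - s₀) ^ 2)⁻¹ *
      (u s t - modeCoeff u s * cos (π / 2 * t)) ^ 2 :=
    integrable_of_continuous_of_bounded (by fun_prop) ⟨R₃, fun s hs => by simp [(hR₃ s hs).1]⟩
  have e1 : ∀ s, G s t =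
      (1 / 2 * α * deriv (fun s => u s t - modeCoeff u s * cos (π / 2 * t)) s ^ 2 +
        1.64 * (u s t - modeCoeff u s * cos (π / 2 * t)) ^ 2) -
      c * ((1 + (s - s₀) ^ 2)⁻¹ * (u s t - modeCoeff u s * cos (π / 2 * t)) ^ 2) := fun s => by
    rw [hd]; simp only [hG]; ring
  have i4 : Integrable fun s =>
      1 / 2 * α * deriv (fun s => u s t - modeCoeff u s * cos (π / 2 * t)) s ^ 2 +
        1.64 * (u s t - modeCoeff u s * cos (π / 2 * t)) ^ 2 :=
      (i1.const_mul _).add (i2.const_mul _)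
  simp_rw [e1]
  rw [integral_sub i4 (i3.const_mul _), integral_add (i1.const_mul _) (i2.const_mul _),
    integral_const_mul, integral_const_mul, integral_const_mul]
  linarith

lemma integrable_intervalIntegral_of_continuous {F : ℝ → ℝ → ℝ}
    (hF : Continuous fun p : ℝ × ℝ => F p.1 p.2) (hb : ∃ R, ∀ s t, R ≤ |s| → F s t = 0) :
    Integrable fun s => ∫ t in (-1 : ℝ)..1, F s t :=
  integrable_of_continuous_of_bounded (continuous_integral_of_continuous hF)
    (hb.imp fun R hR s hs => by simp [hR s _ hs])

lemma continuous_stripWeight_comp {q k : ℝ → ℝ} (hq : Continuous q) (hk : Continuous k) :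
    Continuous fun p : ℝ × ℝ => stripWeight (k p.1) (q p.1) p.2 := by
  fun_prop

lemma integrable_inv_stripWeight {q k : ℝ → ℝ} (hq : Continuous q) (hq0 : ∀ s, 0 ≤ q s)
    (hk : Continuous k) (hk1 : ∀ s, |k s| < 1) {F : ℝ → ℝ → ℝ}
    (hF : Continuous fun p : ℝ × ℝ => F p.1 p.2) (hb : ∃ R, ∀ s t, R ≤ |s| → F s t = 0) :
    Integrable fun s => ∫ t in (-1 : ℝ)..1, (stripWeight (k s) (q s) t)⁻¹ * F s t := by
  let G : ℝ → ℝ → ℝ := fun s t => (stripWeight (k s) (q s) (max (-1) (min 1 t)))⁻¹ * F s t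
  have hG : Continuous fun p : ℝ × ℝ => G p.1 p.2 := by
    refine Continuous.mul (Continuous.inv₀ (by fun_prop) fun p => ?_) hF
    have h1 : |max (-1) (min 1 p.2)| ≤ 1 :=
      abs_le.2 ⟨le_max_left _ _, max_le (by norm_num) (min_le_left _ _)⟩
    have h2 : |max (-1) (min 1 p.2) * k p.1| < 1 := by
      rw [abs_mul]
      exact (mul_le_of_le_one_left (abs_nonneg _) h1).trans_lt (hk1 _)
    have h3 := (abs_lt.1 h2).2
    refine (sqrt_pos.2 ?_).ne'
    have := mul_nonneg (sq_nonneg (max (-1) (min 1 p.2))) (hq0 p.1)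
    have h4 : 0 < 1 - max (-1) (min 1 p.2) * k p.1 := by linarith
    positivity
  have hGb : ∃ R, ∀ s t, R ≤ |s| → G s t = 0 :=
    hb.imp fun R hR s t hs => by simp [G, hR s t hs]
  refine (integrable_intervalIntegral_of_continuous hG hGb).congr
    (Eventually.of_forall fun s => ?_)
  refine intervalIntegral.integral_congr fun t ht => ?_
  rw [uIcc_of_le (by norm_num)] at ht
  simp [G, min_eq_right ht.2, max_eq_right ht.1]

lemma IsStripTest.exists_vanish {u : ℝ → ℝ → ℝ} (hu : IsStripTest u) :
    ∃ R, ∀ s, R ≤ |s| → (∀ t, u s t = 0) ∧ (∀ t, deriv (fun x => u x t) s = 0) ∧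
      ∀ t, deriv (u s) t = 0 := by
  obtain ⟨R₁, hR₁⟩ := hu.longitudinal
  obtain ⟨R₂, hR₂⟩ := hu.deriv_fst.longitudinal
  refine ⟨max R₁ R₂, fun s hs => ?_⟩
  obtain ⟨h1, h2⟩ : R₁ ≤ |s| ∧ R₂ ≤ |s| := by simpa using hs
  refine ⟨fun t => hR₁ s t h1, fun t => hR₂ s t h2, fun t => ?_⟩
  have : u s = fun _ => 0 := funext fun t => hR₁ s t h1
  rw [this, deriv_const]

/-- Stability of the geodesic Hardy inequality under mild curvature. -/
lemma GeoHardy.curved {α c s₀ x₀ : ℝ} {q k x : ℝ → ℝ} (h : GeoHardy α c s₀ q) (hα : 0 ≤ α)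
    (hc : 0 ≤ c) (hq : Continuous q) (hq0 : ∀ s, 0 ≤ q s) (hq2 : ∀ s, q s ≤ 2)
    (hk : Continuous k) (hkx : ∀ s, |k s| ≤ x s) (hx : Continuous x) (hxx : ∀ s, x s ≤ x₀)
    (hx₀ : x₀ ≤ 1 / 3) {u : ℝ → ℝ → ℝ} (hu : IsStripTest u) :
    0 ≤ ∫ s, (α * (∫ t in (-1 : ℝ)..1,
        (stripWeight (k s) (q s) t)⁻¹ * deriv (fun x => u x t) s ^ 2) +
      (∫ t in (-1 : ℝ)..1, stripWeight (k s) (q s) t *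
        (deriv (u s) t ^ 2 - π ^ 2 / 4 * u s t ^ 2)) +
      (π ^ 2 / 4 * (4 / 3 * x s) - c * (1 + x₀)⁻¹ * (1 + (s - s₀) ^ 2)⁻¹) *
        ∫ t in (-1 : ℝ)..1, geoWeight (q s) t * u s t ^ 2) := by
  have hx₀0 : 0 ≤ x₀ := (abs_nonneg _).trans ((hkx 0).trans (hxx 0))
  have hv := hu.isLineTest_modeCoeff
  have hvc := hv.continuous
  have hvd := hv.continuous_deriv
  have huc := hu.continuous
  have hus := hu.continuous_deriv_fst
  have hut := hu.continuous_deriv_snd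
  have hρ := continuous_inv_one_add_sub_sq s₀
  have hN := continuous_modeMass_comp hq
  have hτ := continuous_modePotential_comp hq hq0
  have hgi := continuous_inv_geoWeight_comp hq hq0
  have hg : Continuous fun p : ℝ × ℝ => geoWeight (q p.1) p.2 := by fun_prop
  have hs := continuous_stripWeight_comp hq hk
  obtain ⟨R, hR⟩ := hu.exists_vanish
  obtain ⟨R', hR'⟩ := hv.deriv_bounded
  have hFint : ∀ F : ℝ → ℝ, Continuous F →
      (∀ s, (∀ t, u s t = 0) → (∀ t, deriv (fun x => u x t) s = 0) → (∀ t, deriv (u s) t = 0) →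
        modeCoeff u s = 0 → deriv (modeCoeff u) s = 0 → F s = 0) → Integrable F := by
    refine fun F hF h0 => integrable_of_continuous_of_bounded hF ⟨max R R', fun s hs => ?_⟩
    obtain ⟨h1, h2⟩ : R ≤ |s| ∧ R' ≤ |s| := by simpa using hs
    exact h0 s (hR s h1).1 (hR s h1).2.1 (hR s h1).2.2 (hR' s h2).1 (hR' s h2).2
  have k1 : Continuous fun s => ∫ t in (-1 : ℝ)..1,
      (geoWeight (q s) t)⁻¹ * deriv (fun x => u x t) s ^ 2 :=
    continuous_integral_of_continuous (hgi.mul (hus.pow 2))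
  have k2 : Continuous fun s => ∫ t in (-1 : ℝ)..1, geoWeight (q s) t *
      (deriv (u s) t ^ 2 - π ^ 2 / 4 * u s t ^ 2) :=
    continuous_integral_of_continuous
      (hg.mul ((hut.pow 2).sub (continuous_const.mul (huc.pow 2))))
  have k3 : Continuous fun s => ∫ t in (-1 : ℝ)..1, geoWeight (q s) t * u s t ^ 2 :=
    continuous_integral_of_continuous (hg.mul (huc.pow 2))
  have k4 : Continuous fun s => ∫ t in (-1 : ℝ)..1, deriv (fun x => u x t) s ^ 2 :=
    continuous_integral_of_continuous (hus.pow 2)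
  have k5 : Continuous fun s => ∫ t in (-1 : ℝ)..1, u s t ^ 2 :=
    continuous_integral_of_continuous (huc.pow 2)
  have k6 : Continuous fun s => ∫ t in (-1 : ℝ)..1, stripWeight (k s) (q s) t *
      (deriv (u s) t ^ 2 - π ^ 2 / 4 * u s t ^ 2) :=
    continuous_integral_of_continuous
      (hs.mul ((hut.pow 2).sub (continuous_const.mul (huc.pow 2))))
  let A : ℝ → ℝ := fun s => α * (∫ t in (-1 : ℝ)..1,
      (geoWeight (q s) t)⁻¹ * deriv (fun x => u x t) s ^ 2) +
    (∫ t in (-1 : ℝ)..1, geoWeight (q s) t * (deriv (u s) t ^ 2 - π ^ 2 / 4 * u s t ^ 2))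
  let A' : ℝ → ℝ := fun s =>
    (1 + (s - s₀) ^ 2)⁻¹ * ∫ t in (-1 : ℝ)..1, geoWeight (q s) t * u s t ^ 2
  let B : ℝ → ℝ := fun s =>
    α * deriv (modeCoeff u) s ^ 2 + modePotential (q s) * modeCoeff u s ^ 2
  let B' : ℝ → ℝ := fun s => (1 + (s - s₀) ^ 2)⁻¹ * (modeMass (q s) * modeCoeff u s ^ 2)
  let C : ℝ → ℝ := fun s => 1 / 2 * α * ((∫ t in (-1 : ℝ)..1, deriv (fun x => u x t) s ^ 2) -
      deriv (modeCoeff u) s ^ 2) +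
    (1.64 - c * (1 + (s - s₀) ^ 2)⁻¹) *
      ((∫ t in (-1 : ℝ)..1, u s t ^ 2) - modeCoeff u s ^ 2)
  have hA : c * ∫ s, A' s ≤ ∫ s, A s := h u hu
  have hB : c * ∫ s, B' s ≤ ∫ s, B s := h.mode hα hc hq hq0 hq2 hv
  have hC : 0 ≤ ∫ s, C s := h.orthogonal hα hc hq hq0 hq2 hu
  have iA : Integrable A := hFint _ (by fun_prop) fun s h1 h2 h3 _ _ => by simp [A, h1, h2, h3]
  have iA' : Integrable A' := hFint _ (by fun_prop) fun s h1 _ _ _ _ => by simp [A', h1]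
  have iB : Integrable B := hFint _ (by fun_prop) fun s _ _ _ h4 h5 => by simp [B, h4, h5]
  have iB' : Integrable B' := hFint _ (by fun_prop) fun s _ _ _ h4 _ => by simp [B', h4]
  have iC : Integrable C :=
    hFint _ (by fun_prop) fun s h1 h2 _ h4 h5 => by simp [C, h1, h2, h4, h5]
  set M := 1 - x₀
  set κ := x₀ ^ 2 / (1 + x₀) with hκ
  have hκ0 : 0 ≤ κ := by positivity
  have hMκ : (1 + x₀)⁻¹ = M + κ := by
    rw [hκ]; simp only [M]; field_simp; ring
  have hM0 : 0 ≤ M := by simp only [M]; linarith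
  have i1 : Integrable fun s => A s - c * A' s := iA.sub (iA'.const_mul c)
  have i2 : Integrable fun s => B s - c * B' s := iB.sub (iB'.const_mul c)
  have i3 : Integrable fun s => M * (A s - c * A' s) + 1.6 * κ * (B s - c * B' s) :=
    (i1.const_mul _).add (i2.const_mul _)
  have hlow : 0 ≤ ∫ s, (M * (A s - c * A' s) + 1.6 * κ * (B s - c * B' s) + 2 * κ * C s) := by
    rw [integral_add i3 (iC.const_mul _), integral_add (i1.const_mul _) (i2.const_mul _),
      integral_const_mul, integral_const_mul, integral_const_mul,
      integral_sub iA (iA'.const_mul c), integral_sub iB (iB'.const_mul c), integral_const_mul,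
      integral_const_mul]
    have h1 := sub_nonneg.2 hA
    have h2 := sub_nonneg.2 hB
    positivity
  refine hlow.trans (integral_mono (i3.add (iC.const_mul _)) ?_ fun s => ?_)
  · refine (((integrable_inv_stripWeight hq hq0 hk (fun s => ?_) (hus.pow 2)
      ⟨R, fun s t hs => ?_⟩).const_mul α).add
      (hFint _ k6 fun s h1 _ h3 _ _ => ?_)).add
      (hFint _ (by fun_prop) fun s h1 _ _ _ _ => ?_)
    · exact ((hkx s).trans (hxx s)).trans_lt (by linarith)
    · simp [(hR s hs).2.1 t]
    · simp [h1, h3]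
    · simp [h1]
  · have c1 := (hu.contDiff_slice_snd s).continuous
    have c2 := (hu.deriv_fst.contDiff_slice_snd s).continuous
    have c3 : Continuous fun t => deriv (u s) t :=
      (hu.contDiff_slice_snd s).continuous_deriv (by norm_cast)
    obtain ⟨r, hr, hr0⟩ := hu.transverse
    have e1 := mul_le_mul_of_nonneg_left
      (interval_kinetic_lower (hq0 s) (hq2 s) ((hkx s).trans (hxx s)) hx₀ c2) hα
    have e2 := interval_transverse_lower (hq0 s) (hq2 s) (hkx s) (hxx s) hx₀ hr
      (hu.hasDerivAt_snd s) c3 (hr0 s)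
    have e3 := mul_le_mul_of_nonneg_left (interval_mass_upper (hq0 s) (hq2 s) c1)
      (by positivity : 0 ≤ c * κ * (1 + (s - s₀) ^ 2)⁻¹)
    have e4 : deriv (modeCoeff u) s =
        ∫ t in (-1 : ℝ)..1, cos (π / 2 * t) * deriv (fun x => u x t) s :=
      congrFun hu.deriv_modeCoeff s
    have e5 : modeCoeff u s = ∫ t in (-1 : ℝ)..1, cos (π / 2 * t) * u s t := rfl
    rw [← e4] at e1
    rw [← e5] at e2 e3
    simp only [A, A', B, B', C, hMκ]
    norm_num at e1 e2 e3 ⊢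
    linarith

lemma setIntegral_Ioo_neg_eq {a : ℝ} (ha : 0 < a) (F : ℝ → ℝ) :
    ∫ t in Ioo (-a) a, F t = a * ∫ τ in (-1 : ℝ)..1, F (a * τ) := by
  rw [← integral_Ioc_eq_integral_Ioo, ← intervalIntegral.integral_of_le (by linarith),
    intervalIntegral.integral_comp_mul_left F ha.ne', smul_eq_mul]
  simp [ha.ne']

lemma sqrt_mul_sq_eq_geoWeight (a σ τ : ℝ) :
    √(1 + (a * τ) ^ 2 * σ ^ 2) = geoWeight (a ^ 2 * σ ^ 2) τ := by
  rw [geoWeight]; ring_nf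

lemma sqrt_mul_sq_eq_stripWeight (a k σ τ : ℝ) :
    √((1 - a * τ * k) ^ 2 + (a * τ) ^ 2 * σ ^ 2) = stripWeight (a * k) (a ^ 2 * σ ^ 2) τ := by
  rw [stripWeight]; ring_nf

lemma IsStripTest.integrable_geoWeight {u : ℝ → ℝ → ℝ} (hu : IsStripTest u) {q : ℝ → ℝ}
    (hq : Continuous q) :
    Integrable fun s => ∫ t in (-1 : ℝ)..1, geoWeight (q s) t * u s t ^ 2 := by
  have huc := hu.continuous
  obtain ⟨R, hR⟩ := hu.longitudinal
  exact integrable_intervalIntegral_of_continuous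
    (F := fun s t => geoWeight (q s) t * u s t ^ 2) (by fun_prop)
    ⟨R, fun s t hs => by simp [hR s t hs]⟩

/-- The Hardy inequality on a geodesic strip of half-width `a`, transferred to the strip of
half-width one. -/
lemma geoHardy_of_strip {a c s₀ : ℝ} (ha : 0 < a) {σ : ℝ → ℝ} (hσ : Continuous σ)
    (hHardy : ∀ ψ : ℝ → ℝ → ℂ,
      ContDiff ℝ (⊤ : ℕ∞) (fun p : ℝ × ℝ => ψ p.1 p.2) →
      HasCompactSupport (fun p : ℝ × ℝ => ψ p.1 p.2) →
      tsupport (fun p : ℝ × ℝ => ψ p.1 p.2) ⊆ univ ×ˢ Ioo (-a) a →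
      ((∫ s : ℝ, ∫ t in Ioo (-a) a,
            (Real.sqrt (1 + t ^ 2 * σ s ^ 2))⁻¹ *
              ‖deriv (fun x => ψ x t) s‖ ^ 2) +
          (∫ s : ℝ, ∫ t in Ioo (-a) a,
            Real.sqrt (1 + t ^ 2 * σ s ^ 2) * ‖deriv (ψ s) t‖ ^ 2)) -
          (π ^ 2 / (2 * a) ^ 2) *
            (∫ s : ℝ, ∫ t in Ioo (-a) a,
              ‖ψ s t‖ ^ 2 * Real.sqrt (1 + t ^ 2 * σ s ^ 2)) ≥
        c * ∫ s : ℝ, ∫ t in Ioo (-a) a,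
              (1 + (s - s₀) ^ 2)⁻¹ * ‖ψ s t‖ ^ 2 *
                Real.sqrt (1 + t ^ 2 * σ s ^ 2)) :
    GeoHardy (a ^ 2) (a ^ 2 * c) s₀ fun s => a ^ 2 * σ s ^ 2 := by
  intro u hu
  have huc := hu.continuous
  have hus := hu.continuous_deriv_fst
  have hut := hu.continuous_deriv_snd
  set q : ℝ → ℝ := fun s => a ^ 2 * σ s ^ 2 with hq_def
  have hq : Continuous q := by fun_prop
  have hq0 : ∀ s, 0 ≤ q s := fun s => by positivity
  have hgi := continuous_inv_geoWeight_comp hq hq0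
  have hg : Continuous fun p : ℝ × ℝ => geoWeight (q p.1) p.2 := by fun_prop
  obtain ⟨R, hR⟩ := hu.exists_vanish
  obtain ⟨r, hr, hr0⟩ := hu.transverse
  have hsupp : Function.support (fun p : ℝ × ℝ => ((u p.1 (p.2 / a) : ℝ) : ℂ)) ⊆
      Icc (-R) R ×ˢ Icc (-(r * a)) (r * a) := fun p hp => by
    have hp' : u p.1 (p.2 / a) ≠ 0 := by simpa using hp
    refine ⟨abs_le.1 ?_, abs_le.1 ?_⟩
    · by_contra hcon
      exact hp' ((hR _ (not_le.1 hcon).le).1 _)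
    · by_contra hcon
      refine hp' (hr0 _ _ ?_)
      rw [abs_div, abs_of_pos ha, le_div_iff₀ ha]
      exact (not_le.1 hcon).le
  have key := hHardy (fun s t => (u s (t / a) : ℝ)) ?_ ?_ ?_
  · have d1 : ∀ s t, ‖deriv (fun x => ((u x (t / a) : ℝ) : ℂ)) s‖ ^ 2 =
        deriv (fun x => u x (t / a)) s ^ 2 := fun s t => by
      rw [(hu.hasDerivAt_fst s (t / a)).ofReal_comp.deriv, Complex.norm_real, norm_eq_abs, sq_abs]
    have d2 : ∀ s t, ‖deriv (fun t => ((u s (t / a) : ℝ) : ℂ)) t‖ ^ 2 =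
        a⁻¹ ^ 2 * deriv (u s) (t / a) ^ 2 := fun s t => by
      have h1 : HasDerivAt (fun t : ℝ => t / a) a⁻¹ t := by
        simpa using (hasDerivAt_id t).div_const a
      have h2 := ((hu.hasDerivAt_snd s (t / a)).comp t h1).ofReal_comp
      rw [show (fun t => ((u s (t / a) : ℝ) : ℂ)) =
        fun t => (((u s ∘ fun t => t / a) t : ℝ) : ℂ) from rfl, h2.deriv, Complex.norm_real,
        norm_eq_abs, sq_abs]
      ring
    simp_rw [d1, d2, Complex.norm_real, norm_eq_abs, sq_abs, setIntegral_Ioo_neg_eq ha,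
      sqrt_mul_sq_eq_geoWeight, mul_div_cancel_left₀ _ ha.ne', mul_left_comm _ (a⁻¹ ^ 2),
      mul_assoc, mul_comm (u _ _ ^ 2), intervalIntegral.integral_const_mul, integral_const_mul]
      at key
    have i1 : Integrable fun s => ∫ t in (-1 : ℝ)..1,
        (geoWeight (q s) t)⁻¹ * deriv (fun x => u x t) s ^ 2 :=
      integrable_intervalIntegral_of_continuous (hgi.mul (hus.pow 2))
        ⟨R, fun s t hs => by simp [(hR s hs).2.1 t]⟩
    have i2 : Integrable fun s => ∫ t in (-1 : ℝ)..1, geoWeight (q s) t * deriv (u s) t ^ 2 :=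
      integrable_intervalIntegral_of_continuous (hg.mul (hut.pow 2))
        ⟨R, fun s t hs => by simp [(hR s hs).2.2 t]⟩
    have i3 := hu.integrable_geoWeight hq
    have e1 : ∀ s, ∫ t in (-1 : ℝ)..1, geoWeight (q s) t *
        (deriv (u s) t ^ 2 - π ^ 2 / 4 * u s t ^ 2) =
        (∫ t in (-1 : ℝ)..1, geoWeight (q s) t * deriv (u s) t ^ 2) -
        π ^ 2 / 4 * ∫ t in (-1 : ℝ)..1, geoWeight (q s) t * u s t ^ 2 := fun s => by
      have c1 := (hu.contDiff_slice_snd s).continuous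
      have c3 : Continuous fun t => deriv (u s) t :=
        (hu.contDiff_slice_snd s).continuous_deriv (by norm_cast)
      rw [← intervalIntegral.integral_const_mul, ← intervalIntegral.integral_sub
        ((by fun_prop : Continuous _).intervalIntegrable _ _)
        ((by fun_prop : Continuous _).intervalIntegrable _ _)]
      congr! 2 with t
      ring
    simp_rw [e1]
    have i4 : Integrable fun s => (∫ t in (-1 : ℝ)..1, geoWeight (q s) t * deriv (u s) t ^ 2) -
        π ^ 2 / 4 * ∫ t in (-1 : ℝ)..1, geoWeight (q s) t * u s t ^ 2 := i2.sub (i3.const_mul _)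
    rw [integral_add (i1.const_mul _) i4, integral_sub i2 (i3.const_mul _), integral_const_mul,
      integral_const_mul]
    have key' := mul_le_mul_of_nonneg_left key ha.le
    have e2 : ∀ K T m : ℝ, a * (a * K + a * (a⁻¹ ^ 2 * T) - π ^ 2 / (2 * a) ^ 2 * (a * m)) =
        a ^ 2 * K + (T - π ^ 2 / 4 * m) := fun K T m => by
      field_simp
      ring
    rw [e2] at key'
    refine le_trans (le_of_eq ?_) key'
    ring
  · exact Complex.ofRealCLM.contDiff.comp (hu.contDiff.comp
      (contDiff_fst.prodMk (contDiff_snd.div_const a)))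
  · exact HasCompactSupport.intro (isCompact_Icc.prod isCompact_Icc)
      fun p hp => Function.notMem_support.1 fun h => hp (hsupp h)
  · refine (closure_minimal hsupp (isClosed_Icc.prod isClosed_Icc)).trans ?_
    refine prod_mono (subset_univ _) fun t ht => ?_
    have : r * a < a := by nlinarith
    exact ⟨by linarith [ht.1], by linarith [ht.2]⟩

lemma IsStripTest.integrable_inv_stripWeight {u : ℝ → ℝ → ℝ} (hu : IsStripTest u) {q k : ℝ → ℝ}
    (hq : Continuous q) (hq0 : ∀ s, 0 ≤ q s) (hk : Continuous k) (hk1 : ∀ s, |k s| < 1) :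
    Integrable fun s => ∫ t in (-1 : ℝ)..1,
      (stripWeight (k s) (q s) t)⁻¹ * deriv (fun x => u x t) s ^ 2 := by
  obtain ⟨R, hR⟩ := hu.exists_vanish
  exact _root_.integrable_inv_stripWeight hq hq0 hk hk1 (hu.continuous_deriv_fst.pow 2)
    ⟨R, fun s t hs => by simp [(hR s hs).2.1 t]⟩

lemma IsStripTest.integrable_stripWeight_deriv {u : ℝ → ℝ → ℝ} (hu : IsStripTest u) {q k : ℝ → ℝ}
    (hq : Continuous q) (hk : Continuous k) :
    Integrable fun s => ∫ t in (-1 : ℝ)..1, stripWeight (k s) (q s) t * deriv (u s) t ^ 2 := by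
  obtain ⟨R, hR⟩ := hu.exists_vanish
  exact integrable_intervalIntegral_of_continuous
    ((continuous_stripWeight_comp hq hk).mul (hu.continuous_deriv_snd.pow 2))
    ⟨R, fun s t hs => by simp [(hR s hs).2.2 t]⟩

lemma IsStripTest.integrable_stripWeight {u : ℝ → ℝ → ℝ} (hu : IsStripTest u) {q k : ℝ → ℝ}
    (hq : Continuous q) (hk : Continuous k) :
    Integrable fun s => ∫ t in (-1 : ℝ)..1, stripWeight (k s) (q s) t * u s t ^ 2 := by
  obtain ⟨R, hR⟩ := hu.exists_vanish
  exact integrable_intervalIntegral_of_continuous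
    ((continuous_stripWeight_comp hq hk).mul (hu.continuous.pow 2))
    ⟨R, fun s t hs => by simp [(hR s hs).1 t]⟩

lemma IsStripTest.intervalIntegrable_inv_stripWeight {u : ℝ → ℝ → ℝ} (hu : IsStripTest u)
    {q k : ℝ → ℝ} (hq0 : ∀ s, 0 ≤ q s) (hk1 : ∀ s, |k s| < 1) (s : ℝ) :
    IntervalIntegrable (fun t => (stripWeight (k s) (q s) t)⁻¹ * deriv (fun x => u x t) s ^ 2)
      volume (-1) 1 := by
  refine ContinuousOn.intervalIntegrable_of_Icc (by norm_num) ?_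
  exact (continuousOn_inv_stripWeight (hq0 s) (hk1 s)).mul
    ((hu.continuous_deriv_fst.comp (Continuous.prodMk_right s)).pow 2).continuousOn

lemma IsStripTest.intervalIntegrable_stripWeight_deriv {u : ℝ → ℝ → ℝ} (hu : IsStripTest u)
    (k q : ℝ → ℝ) (s : ℝ) :
    IntervalIntegrable (fun t => stripWeight (k s) (q s) t * deriv (u s) t ^ 2)
      volume (-1) 1 := by
  have : Continuous fun t => deriv (u s) t :=
    (hu.contDiff_slice_snd s).continuous_deriv (by norm_cast)
  exact (by fun_prop : Continuous _).intervalIntegrable _ _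

/-- Hardy inequality on the curved strip of half-width one, for real test functions. -/
lemma GeoHardy.strip_bound {α c s₀ x₀ : ℝ} {q k x W : ℝ → ℝ} (h : GeoHardy α c s₀ q)
    (hα : 0 ≤ α) (hc : 0 ≤ c) (hq : Continuous q) (hq0 : ∀ s, 0 ≤ q s) (hq2 : ∀ s, q s ≤ 2)
    (hk : Continuous k) (hkx : ∀ s, |k s| ≤ x s) (hx : Continuous x) (hxx : ∀ s, x s ≤ x₀)
    (hx₀ : x₀ ≤ 1 / 3) (hW : Continuous W)
    (hWle : ∀ s, W s ≤ c * (1 + x₀)⁻¹ * (1 + (s - s₀) ^ 2)⁻¹ - π ^ 2 / 4 * (4 / 3 * x s))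
    {u : ℝ → ℝ → ℝ} (hu : IsStripTest u) :
    (∫ s, W s * ∫ t in (-1 : ℝ)..1, geoWeight (q s) t * u s t ^ 2) ≤
      α * (∫ s, ∫ t in (-1 : ℝ)..1,
        (stripWeight (k s) (q s) t)⁻¹ * deriv (fun x => u x t) s ^ 2) +
      ((∫ s, ∫ t in (-1 : ℝ)..1, stripWeight (k s) (q s) t * deriv (u s) t ^ 2) -
        π ^ 2 / 4 * ∫ s, ∫ t in (-1 : ℝ)..1, stripWeight (k s) (q s) t * u s t ^ 2) := by
  have huc := hu.continuous
  have hρ := continuous_inv_one_add_sub_sq s₀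
  have hg : Continuous fun p : ℝ × ℝ => geoWeight (q p.1) p.2 := by fun_prop
  obtain ⟨R, hR⟩ := hu.exists_vanish
  have i1 := hu.integrable_inv_stripWeight hq hq0 hk
    fun s => ((hkx s).trans (hxx s)).trans_lt (by linarith)
  have i2 := hu.integrable_stripWeight_deriv hq hk
  have i3 := hu.integrable_stripWeight hq hk
  have cg : Continuous fun s => ∫ t in (-1 : ℝ)..1, geoWeight (q s) t * u s t ^ 2 :=
    continuous_integral_of_continuous (hg.mul (huc.pow 2))
  have hb : ∀ f : ℝ → ℝ, Continuous f →
      Integrable fun s => f s * ∫ t in (-1 : ℝ)..1, geoWeight (q s) t * u s t ^ 2 := fun f hf =>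
    integrable_of_continuous_of_bounded (hf.mul cg) ⟨R, fun s hs => by simp [(hR s hs).1]⟩
  have i4 := hb (fun s => π ^ 2 / 4 * (4 / 3 * x s) - c * (1 + x₀)⁻¹ * (1 + (s - s₀) ^ 2)⁻¹)
    (by fun_prop)
  have i5 := hb W hW
  have e1 : ∀ s, ∫ t in (-1 : ℝ)..1, stripWeight (k s) (q s) t *
      (deriv (u s) t ^ 2 - π ^ 2 / 4 * u s t ^ 2) =
      (∫ t in (-1 : ℝ)..1, stripWeight (k s) (q s) t * deriv (u s) t ^ 2) -
      π ^ 2 / 4 * ∫ t in (-1 : ℝ)..1, stripWeight (k s) (q s) t * u s t ^ 2 := fun s => by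
    have c1 := (hu.contDiff_slice_snd s).continuous
    have c3 : Continuous fun t => deriv (u s) t :=
      (hu.contDiff_slice_snd s).continuous_deriv (by norm_cast)
    rw [← intervalIntegral.integral_const_mul, ← intervalIntegral.integral_sub
      ((by fun_prop : Continuous _).intervalIntegrable _ _)
      ((by fun_prop : Continuous _).intervalIntegrable _ _)]
    congr! 2 with t
    ring
  have key := h.curved hα hc hq hq0 hq2 hk hkx hx hxx hx₀ hu
  simp_rw [e1] at key
  have i6 : Integrable fun s =>
      (∫ t in (-1 : ℝ)..1, stripWeight (k s) (q s) t * deriv (u s) t ^ 2) -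
      π ^ 2 / 4 * ∫ t in (-1 : ℝ)..1, stripWeight (k s) (q s) t * u s t ^ 2 :=
    i2.sub (i3.const_mul _)
  have i7 : Integrable fun s => α * (∫ t in (-1 : ℝ)..1,
        (stripWeight (k s) (q s) t)⁻¹ * deriv (fun x => u x t) s ^ 2) +
      ((∫ t in (-1 : ℝ)..1, stripWeight (k s) (q s) t * deriv (u s) t ^ 2) -
      π ^ 2 / 4 * ∫ t in (-1 : ℝ)..1, stripWeight (k s) (q s) t * u s t ^ 2) :=
    (i1.const_mul α).add i6
  rw [integral_add i7 i4, integral_add (i1.const_mul α) i6, integral_sub i2 (i3.const_mul _),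
    integral_const_mul, integral_const_mul] at key
  have hle : (∫ s, W s * ∫ t in (-1 : ℝ)..1, geoWeight (q s) t * u s t ^ 2) ≤
      ∫ s, -((π ^ 2 / 4 * (4 / 3 * x s) - c * (1 + x₀)⁻¹ * (1 + (s - s₀) ^ 2)⁻¹) *
        ∫ t in (-1 : ℝ)..1, geoWeight (q s) t * u s t ^ 2) := by
    refine integral_mono i5 i4.neg fun s => ?_
    have h1 : 0 ≤ ∫ t in (-1 : ℝ)..1, geoWeight (q s) t * u s t ^ 2 :=
      intervalIntegral.integral_nonneg (by norm_num) fun t _ =>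
        mul_nonneg (geoWeight_pos (hq0 s) t).le (sq_nonneg _)
    have h2 := mul_le_mul_of_nonneg_right (hWle s) h1
    dsimp only
    linarith
  rw [integral_neg] at hle
  linarith

lemma isStripTest_of_tsupport_subset {a : ℝ} (ha : 0 < a) {ψ : ℝ → ℝ → ℂ}
    (hψ : ContDiff ℝ (⊤ : ℕ∞) fun p : ℝ × ℝ => ψ p.1 p.2)
    (hcomp : HasCompactSupport fun p : ℝ × ℝ => ψ p.1 p.2)
    (hsub : tsupport (fun p : ℝ × ℝ => ψ p.1 p.2) ⊆ univ ×ˢ Ioo (-a) a) (L : ℂ →L[ℝ] ℝ) :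
    IsStripTest fun s t => L (ψ s (a * t)) := by
  have hzero : ∀ s t, (s, a * t) ∉ tsupport (fun p : ℝ × ℝ => ψ p.1 p.2) →
      L (ψ s (a * t)) = 0 := fun s t h => by
    rw [show ψ s (a * t) = 0 from image_eq_zero_of_notMem_tsupport
      (f := fun p : ℝ × ℝ => ψ p.1 p.2) (x := (s, a * t)) h, map_zero]
  refine ⟨?_, ?_, ?_⟩
  · exact L.contDiff.comp (hψ.comp (contDiff_fst.prodMk (contDiff_const.mul contDiff_snd)))
  · rcases (tsupport fun p : ℝ × ℝ => ψ p.1 p.2).eq_empty_or_nonempty with he | hne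
    · exact ⟨0, one_pos, fun s t _ => hzero s t (by simp [he])⟩
    obtain ⟨p, hp, hmax⟩ := hcomp.isCompact.exists_isMaxOn hne
      (f := fun p : ℝ × ℝ => |p.2|) (by fun_prop)
    have hpa : |p.2| / a < 1 := (div_lt_one ha).2 (abs_lt.2 (hsub hp).2)
    refine ⟨(|p.2| / a + 1) / 2, by linarith, fun s t ht => hzero s t fun hmem => ?_⟩
    have h1 : |a * t| ≤ |p.2| := hmax hmem
    rw [abs_mul, abs_of_pos ha, ← le_div_iff₀' ha] at h1
    linarith
  · obtain ⟨R, hR⟩ := hcomp.isCompact.exists_bound_of_continuousOn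
      (f := fun p : ℝ × ℝ => p.1) (by fun_prop)
    refine ⟨R + 1, fun s t hs => hzero s t fun hmem => ?_⟩
    have : |s| ≤ R := hR _ hmem
    linarith

lemma norm_sq_eq_re_add_im (z : ℂ) : ‖z‖ ^ 2 = Complex.reCLM z ^ 2 + Complex.imCLM z ^ 2 := by
  rw [Complex.sq_norm, Complex.normSq_apply, Complex.reCLM_apply, Complex.imCLM_apply]
  ring

lemma deriv_clm_scaled_fst {a : ℝ} {ψ : ℝ → ℝ → ℂ}
    (hψ : ContDiff ℝ (⊤ : ℕ∞) fun p : ℝ × ℝ => ψ p.1 p.2) (L : ℂ →L[ℝ] ℝ) (s t : ℝ) :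
    deriv (fun x => L (ψ x (a * t))) s = L (deriv (fun x => ψ x (a * t)) s) := by
  have h : ContDiff ℝ (⊤ : ℕ∞) fun x => ψ x (a * t) :=
    hψ.comp (contDiff_id.prodMk contDiff_const)
  exact (L.hasFDerivAt.comp_hasDerivAt s
    (h.differentiable (by simp) s).hasDerivAt).deriv

lemma deriv_clm_scaled_snd {a : ℝ} {ψ : ℝ → ℝ → ℂ}
    (hψ : ContDiff ℝ (⊤ : ℕ∞) fun p : ℝ × ℝ => ψ p.1 p.2) (L : ℂ →L[ℝ] ℝ) (s t : ℝ) :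
    deriv (fun t => L (ψ s (a * t))) t = a * L (deriv (ψ s) (a * t)) := by
  have h : ContDiff ℝ (⊤ : ℕ∞) (ψ s) := hψ.comp (contDiff_const.prodMk contDiff_id)
  have h1 : HasDerivAt (fun t : ℝ => a * t) a t := by
    simpa using (hasDerivAt_id t).const_mul a
  have h2 := (h.differentiable (by simp) (a * t)).hasDerivAt.scomp t h1
  have h3 := (L.hasFDerivAt.comp_hasDerivAt t h2).deriv
  rw [map_smul, smul_eq_mul] at h3
  exact h3

lemma integral_mul_sq_add_sq {G A B : ℝ → ℝ → ℝ}
    (hA : ∀ s, IntervalIntegrable (fun t => G s t * A s t ^ 2) volume (-1) 1)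
    (hB : ∀ s, IntervalIntegrable (fun t => G s t * B s t ^ 2) volume (-1) 1)
    (iA : Integrable fun s => ∫ t in (-1 : ℝ)..1, G s t * A s t ^ 2)
    (iB : Integrable fun s => ∫ t in (-1 : ℝ)..1, G s t * B s t ^ 2) :
    ∫ s, ∫ t in (-1 : ℝ)..1, G s t * (A s t ^ 2 + B s t ^ 2) =
      (∫ s, ∫ t in (-1 : ℝ)..1, G s t * A s t ^ 2) +
      ∫ s, ∫ t in (-1 : ℝ)..1, G s t * B s t ^ 2 := by
  rw [← integral_add iA iB]
  congr! 2 with s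
  rw [← intervalIntegral.integral_add (hA s) (hB s)]
  congr! 2 with t
  ring

/-- Comparison of the two extremal Jacobians of a strip whose squared scaled curvature is at
most two. -/
lemma sqrt_sub_sqrt_ge {x m : ℝ} (hx0 : 0 ≤ x) (hx : x ≤ 1 / 3) (hm0 : 0 ≤ m) (hm : m ≤ 2) :
    √(1 + x * (2 + x)) = 1 + x ∧ √(1 - x * (2 + x) / (1 + m)) ≤ 1 - x / 3 := by
  constructor
  · rw [show 1 + x * (2 + x) = (1 + x) ^ 2 by ring, sqrt_sq (by linarith)]
  · refine sqrt_le_iff.2 ⟨by linarith, ?_⟩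
    have h1 : x * (2 + x) / 3 ≤ x * (2 + x) / (1 + m) := by
      apply div_le_div_of_nonneg_left <;> first | positivity | linarith
    nlinarith

end StripHardy

/-- **Hardy inequality for mildly curved strips.** Given the geodesic Hardy
inequality with constant `c > 0` and centre `s₀` (where `σ s₀ ≠ 0`), and a
mild curvature `|k(s)| ≤ ε(s) = ε₀/(1+s²)` with `ε₀ ∈ [0,(3a)⁻¹]`, one has,
for every test function `ψ ∈ C_c^∞(ℝ × (-a,a))`,
`Q[ψ] - E₁‖ψ‖²_H ≥ ∫ w |ψ|² h₀`, where
`w(s,t) = c min{f₊(0)⁻¹, f₋(0)}/(1+(s-s₀)²) - E₁ (f₊(s) - f₋(s))`. -/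
theorem hardy_mildly_curved_strip
    (a : ℝ) (ha : 0 < a)
    (σ k : ℝ → ℝ) (hσcont : Continuous σ) (hσbdd : ∃ M, ∀ s, |σ s| ≤ M)
    (hkcont : Continuous k)
    (hσne : ∃ s, σ s ≠ 0)
    (hthin : a * (⨆ s, |σ s|) < Real.sqrt 2)
    (ε₀ : ℝ) (hε₀0 : 0 ≤ ε₀) (hε₀1 : ε₀ ≤ (3 * a)⁻¹)
    (hk : ∀ s, |k s| ≤ ε₀ / (1 + s ^ 2))
    (s₀ : ℝ) (hs₀ : σ s₀ ≠ 0)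
    (c : ℝ) (hc : 0 < c)
    -- the geodesic Hardy inequality with constant `c` and weight `ρ⁻¹`:
    (hHardy : ∀ ψ : ℝ → ℝ → ℂ,
      ContDiff ℝ (⊤ : ℕ∞) (fun p : ℝ × ℝ => ψ p.1 p.2) →
      HasCompactSupport (fun p : ℝ × ℝ => ψ p.1 p.2) →
      tsupport (fun p : ℝ × ℝ => ψ p.1 p.2) ⊆ univ ×ˢ Ioo (-a) a →
      ((∫ s : ℝ, ∫ t in Ioo (-a) a,
            (Real.sqrt (1 + t ^ 2 * σ s ^ 2))⁻¹ *
              ‖deriv (fun x => ψ x t) s‖ ^ 2) +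
          (∫ s : ℝ, ∫ t in Ioo (-a) a,
            Real.sqrt (1 + t ^ 2 * σ s ^ 2) * ‖deriv (ψ s) t‖ ^ 2)) -
          (π ^ 2 / (2 * a) ^ 2) *
            (∫ s : ℝ, ∫ t in Ioo (-a) a,
              ‖ψ s t‖ ^ 2 * Real.sqrt (1 + t ^ 2 * σ s ^ 2)) ≥
        c * ∫ s : ℝ, ∫ t in Ioo (-a) a,
              (1 + (s - s₀) ^ 2)⁻¹ * ‖ψ s t‖ ^ 2 *
                Real.sqrt (1 + t ^ 2 * σ s ^ 2))
    (fm fp : ℝ → ℝ)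
    (hfm : ∀ s, fm s =
      Real.sqrt (1 - a * (ε₀ / (1 + s ^ 2)) * (2 + a * (ε₀ / (1 + s ^ 2))) /
        (1 + a ^ 2 * (⨆ x, |σ x|) ^ 2)))
    (hfp : ∀ s, fp s =
      Real.sqrt (1 + a * (ε₀ / (1 + s ^ 2)) * (2 + a * (ε₀ / (1 + s ^ 2)))))
    (w : ℝ → ℝ → ℝ)
    (hw : ∀ s t, w s t =
      c * min (fp 0)⁻¹ (fm 0) / (1 + (s - s₀) ^ 2) -
        (π ^ 2 / (2 * a) ^ 2) * (fp s - fm s)) :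
    ∀ ψ : ℝ → ℝ → ℂ,
      ContDiff ℝ (⊤ : ℕ∞) (fun p : ℝ × ℝ => ψ p.1 p.2) →
      HasCompactSupport (fun p : ℝ × ℝ => ψ p.1 p.2) →
      tsupport (fun p : ℝ × ℝ => ψ p.1 p.2) ⊆ univ ×ˢ Ioo (-a) a →
      ((∫ s : ℝ, ∫ t in Ioo (-a) a,
            (Real.sqrt ((1 - t * k s) ^ 2 + t ^ 2 * σ s ^ 2))⁻¹ *
              ‖deriv (fun x => ψ x t) s‖ ^ 2) +
          (∫ s : ℝ, ∫ t in Ioo (-a) a,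
            Real.sqrt ((1 - t * k s) ^ 2 + t ^ 2 * σ s ^ 2) *
              ‖deriv (ψ s) t‖ ^ 2)) -
          (π ^ 2 / (2 * a) ^ 2) *
            (∫ s : ℝ, ∫ t in Ioo (-a) a,
              ‖ψ s t‖ ^ 2 * Real.sqrt ((1 - t * k s) ^ 2 + t ^ 2 * σ s ^ 2)) ≥
        ∫ s : ℝ, ∫ t in Ioo (-a) a,
          w s t * ‖ψ s t‖ ^ 2 * Real.sqrt (1 + t ^ 2 * σ s ^ 2) := by
  intro ψ hψ hcomp hsub
  set S := ⨆ s, |σ s|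
  have hSσ : ∀ s, |σ s| ≤ S := fun s => le_ciSup (f := fun s => |σ s|)
    (by obtain ⟨M, hM⟩ := hσbdd; exact ⟨M, by rintro _ ⟨s, rfl⟩; exact hM s⟩) s
  have hS0 : 0 ≤ S := (abs_nonneg _).trans (hSσ 0)
  have hm2 : a ^ 2 * S ^ 2 ≤ 2 := by
    have := (lt_sqrt (by positivity)).1 hthin
    nlinarith
  have hx₀ : a * ε₀ ≤ 1 / 3 := by
    calc a * ε₀ ≤ a * (3 * a)⁻¹ := by gcongr
      _ = 1 / 3 := by field_simp
  set x : ℝ → ℝ := fun s => a * (ε₀ / (1 + s ^ 2)) with hx_def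
  have hx : Continuous x :=
    continuous_const.mul (continuous_const.div (by fun_prop) fun s => by positivity)
  have hx0 : ∀ s, 0 ≤ x s := fun s => by positivity
  have hxx : ∀ s, x s ≤ a * ε₀ := fun s =>
    mul_le_mul_of_nonneg_left (div_le_self hε₀0 (by nlinarith [sq_nonneg s])) ha.le
  have hf := fun s => sqrt_sub_sqrt_ge (hx0 s) ((hxx s).trans hx₀) (by positivity) hm2
  have hfp' : ∀ s, fp s = 1 + x s := fun s => (hfp s).trans (hf s).1
  have hfm' : ∀ s, fm s ≤ 1 - x s / 3 := fun s => (hfm s).trans_le (hf s).2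
  have hfmc : Continuous fm := by
    rw [show fm = _ from funext hfm]
    change Continuous fun s => √(1 - x s * (2 + x s) / (1 + a ^ 2 * S ^ 2))
    fun_prop
  have hfpc : Continuous fp := by
    rw [show fp = _ from funext hfp']
    fun_prop
  set W : ℝ → ℝ := fun s => c * min (fp 0)⁻¹ (fm 0) / (1 + (s - s₀) ^ 2) -
    (π ^ 2 / (2 * a) ^ 2) * (fp s - fm s) with hW_def
  have hWc : Continuous W := by
    have : Continuous fun s => c * min (fp 0)⁻¹ (fm 0) / (1 + (s - s₀) ^ 2) :=
      continuous_const.div (by fun_prop) fun s => by positivity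
    fun_prop
  have hWle : ∀ s, a ^ 2 * W s ≤ a ^ 2 * c * (1 + a * ε₀)⁻¹ * (1 + (s - s₀) ^ 2)⁻¹ -
      π ^ 2 / 4 * (4 / 3 * x s) := fun s => by
    have h1 : min (fp 0)⁻¹ (fm 0) ≤ (1 + a * ε₀)⁻¹ := by
      refine (min_le_left _ _).trans_eq ?_
      rw [hfp', hx_def]
      norm_num
    have h2 : a ^ 2 * W s = a ^ 2 * c * min (fp 0)⁻¹ (fm 0) * (1 + (s - s₀) ^ 2)⁻¹ -
        π ^ 2 / 4 * (fp s - fm s) := by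
      rw [hW_def]
      field_simp
      ring
    have h3 : 4 / 3 * x s ≤ fp s - fm s := by linarith [hfp' s, hfm' s]
    rw [h2]
    gcongr
  set q : ℝ → ℝ := fun s => a ^ 2 * σ s ^ 2 with hq_def
  have hq : Continuous q := by fun_prop
  have hq0 : ∀ s, 0 ≤ q s := fun s => by positivity
  have hq2 : ∀ s, q s ≤ 2 := fun s => by
    have : σ s ^ 2 ≤ S ^ 2 := sq_le_sq.2 ((hSσ s).trans (le_abs_self S))
    exact (mul_le_mul_of_nonneg_left this (by positivity)).trans hm2
  set κ : ℝ → ℝ := fun s => a * k s with hκ_def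
  have hκ : Continuous κ := by fun_prop
  have hκx : ∀ s, |κ s| ≤ x s := fun s => by
    rw [hκ_def, abs_mul, abs_of_pos ha]
    exact mul_le_mul_of_nonneg_left (hk s) ha.le
  have hκ1 : ∀ s, |κ s| < 1 := fun s => ((hκx s).trans (hxx s)).trans_lt (by linarith)
  have hs := continuous_stripWeight_comp hq hκ
  have hu := isStripTest_of_tsupport_subset ha hψ hcomp hsub Complex.reCLM
  have hv := isStripTest_of_tsupport_subset ha hψ hcomp hsub Complex.imCLM
  set u : ℝ → ℝ → ℝ := fun s t => Complex.reCLM (ψ s (a * t)) with hu_def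
  set v : ℝ → ℝ → ℝ := fun s t => Complex.imCLM (ψ s (a * t)) with hv_def
  have hH := geoHardy_of_strip ha hσcont hHardy
  have bound : ∀ u, IsStripTest u → _ := fun u hu =>
    hH.strip_bound (W := fun s => a ^ 2 * W s) (by positivity) (by positivity) hq hq0 hq2 hκ hκx
      hx hxx hx₀ (by fun_prop) hWle hu
  have bu := bound u hu
  have bv := bound v hv
  have n0 : ∀ s t, ‖ψ s (a * t)‖ ^ 2 = u s t ^ 2 + v s t ^ 2 := fun s t =>
    norm_sq_eq_re_add_im _
  have n1 : ∀ s t, ‖deriv (fun x => ψ x (a * t)) s‖ ^ 2 =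
      deriv (fun x => u x t) s ^ 2 + deriv (fun x => v x t) s ^ 2 := fun s t => by
    rw [hu_def, hv_def, deriv_clm_scaled_fst hψ, deriv_clm_scaled_fst hψ, norm_sq_eq_re_add_im]
  have n2 : ∀ s t, ‖deriv (ψ s) (a * t)‖ ^ 2 =
      a⁻¹ ^ 2 * (deriv (u s) t ^ 2 + deriv (v s) t ^ 2) := fun s t => by
    rw [hu_def, hv_def, deriv_clm_scaled_snd hψ, deriv_clm_scaled_snd hψ, norm_sq_eq_re_add_im]
    field_simp
  have si : ∀ (u : ℝ → ℝ → ℝ), IsStripTest u → ∀ s, IntervalIntegrable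
      (fun t => stripWeight (κ s) (q s) t * u s t ^ 2) volume (-1) 1 := fun u hu s => by
    have := (hu.contDiff_slice_snd s).continuous
    exact (by fun_prop : Continuous _).intervalIntegrable _ _
  have eK : (∫ s : ℝ, ∫ t in Ioo (-a) a, (√((1 - t * k s) ^ 2 + t ^ 2 * σ s ^ 2))⁻¹ *
      ‖deriv (fun x => ψ x t) s‖ ^ 2) =
      a * ((∫ s, ∫ t in (-1 : ℝ)..1,
        (stripWeight (κ s) (q s) t)⁻¹ * deriv (fun x => u x t) s ^ 2) +
      ∫ s, ∫ t in (-1 : ℝ)..1,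
        (stripWeight (κ s) (q s) t)⁻¹ * deriv (fun x => v x t) s ^ 2) := by
    simp_rw [setIntegral_Ioo_neg_eq ha, sqrt_mul_sq_eq_stripWeight, n1, integral_const_mul]
    rw [integral_mul_sq_add_sq (hu.intervalIntegrable_inv_stripWeight hq0 hκ1)
      (hv.intervalIntegrable_inv_stripWeight hq0 hκ1)
      (hu.integrable_inv_stripWeight hq hq0 hκ hκ1) (hv.integrable_inv_stripWeight hq hq0 hκ hκ1)]
  have eT : (∫ s : ℝ, ∫ t in Ioo (-a) a, √((1 - t * k s) ^ 2 + t ^ 2 * σ s ^ 2) *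
      ‖deriv (ψ s) t‖ ^ 2) =
      a⁻¹ * ((∫ s, ∫ t in (-1 : ℝ)..1, stripWeight (κ s) (q s) t * deriv (u s) t ^ 2) +
      ∫ s, ∫ t in (-1 : ℝ)..1, stripWeight (κ s) (q s) t * deriv (v s) t ^ 2) := by
    simp_rw [setIntegral_Ioo_neg_eq ha, sqrt_mul_sq_eq_stripWeight, n2,
      mul_left_comm _ (a⁻¹ ^ 2), intervalIntegral.integral_const_mul, integral_const_mul]
    rw [integral_mul_sq_add_sq (hu.intervalIntegrable_stripWeight_deriv κ q)
      (hv.intervalIntegrable_stripWeight_deriv κ q)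
      (hu.integrable_stripWeight_deriv hq hκ) (hv.integrable_stripWeight_deriv hq hκ)]
    field_simp
  have eM : (∫ s : ℝ, ∫ t in Ioo (-a) a,
      ‖ψ s t‖ ^ 2 * √((1 - t * k s) ^ 2 + t ^ 2 * σ s ^ 2)) =
      a * ((∫ s, ∫ t in (-1 : ℝ)..1, stripWeight (κ s) (q s) t * u s t ^ 2) +
      ∫ s, ∫ t in (-1 : ℝ)..1, stripWeight (κ s) (q s) t * v s t ^ 2) := by
    simp_rw [setIntegral_Ioo_neg_eq ha, sqrt_mul_sq_eq_stripWeight, n0, integral_const_mul,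
      mul_comm (u _ _ ^ 2 + v _ _ ^ 2)]
    rw [integral_mul_sq_add_sq (si u hu) (si v hv)
      (hu.integrable_stripWeight hq hκ) (hv.integrable_stripWeight hq hκ)]
  have eR : (∫ s : ℝ, ∫ t in Ioo (-a) a,
      w s t * ‖ψ s t‖ ^ 2 * √(1 + t ^ 2 * σ s ^ 2)) =
      a * ((∫ s, W s * ∫ t in (-1 : ℝ)..1, geoWeight (q s) t * u s t ^ 2) +
      ∫ s, W s * ∫ t in (-1 : ℝ)..1, geoWeight (q s) t * v s t ^ 2) := by
    have cu : ∀ (u : ℝ → ℝ → ℝ), IsStripTest u → ∀ s, IntervalIntegrable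
        (fun t => W s * geoWeight (q s) t * u s t ^ 2) volume (-1) 1 := fun u hu s => by
      have := (hu.contDiff_slice_snd s).continuous
      exact (by fun_prop : Continuous _).intervalIntegrable _ _
    have iu : ∀ (u : ℝ → ℝ → ℝ), IsStripTest u → Integrable fun s =>
        ∫ t in (-1 : ℝ)..1, W s * geoWeight (q s) t * u s t ^ 2 := fun u hu => by
      have := hu.continuous
      obtain ⟨R, hR⟩ := hu.longitudinal
      exact integrable_intervalIntegral_of_continuous
        (F := fun s t => W s * geoWeight (q s) t * u s t ^ 2) (by fun_prop)
        ⟨R, fun s t hs => by simp [hR s t hs]⟩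
    have hwW : ∀ s t, w s t = W s := hw
    simp_rw [setIntegral_Ioo_neg_eq ha, sqrt_mul_sq_eq_geoWeight, n0, hwW,
      mul_right_comm (W _), integral_const_mul]
    rw [integral_mul_sq_add_sq (cu u hu) (cu v hv) (iu u hu) (iu v hv)]
    simp_rw [mul_assoc, intervalIntegral.integral_const_mul]
  rw [eK, eT, eM, eR, ge_iff_le]
  simp_rw [mul_assoc, integral_const_mul] at bu bv
  refine le_of_mul_le_mul_left ?_ ha
  refine le_trans (le_of_eq ?_) ((add_le_add bu bv).trans (le_of_eq ?_))
  · ring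
  · field_simp
    ring
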